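/- arXiv:2001.09904 — 5 statements merged into one kernel-verified Lean document; each statement's English description precedes it below -/
import Mathlib

section
/- Let F be a finitely generated free group with a fixed basis, let a, b, c ∈ F be reduced words with a cyclically reduced, let m ≥ 9 be an integer, and let j ∈ {7, 8}. If |a^m b^m c^j| < |a|, then one of the elements a, b, c commutes with a conjugate of another one of them or with a conjugate of the inverse of another one of them. -/
/-- An element of a free group is cyclically reduced if its square has twice its length. -/
def IsCyclicallyReduced {α : Type} [DecidableEq α] (w : FreeGroup α) : Prop :=
  (w * w).norm = 2 * w.norm

namespace ShortProd

variable {α : Type} [DecidableEq α]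

lemma norm_one_eq (l : FreeGroup α) (h : l.norm = 1) : ∃ p, l = FreeGroup.mk [p] := by
  unfold FreeGroup.norm at h
  obtain ⟨p, hp⟩ := List.length_eq_one_iff.1 h
  exact ⟨p, by rw [← hp, FreeGroup.mk_toWord]⟩

lemma toWord_step (p : α × Bool) (g : FreeGroup α) :
    (FreeGroup.mk [p] * g).toWord = FreeGroup.reduce (p :: g.toWord) := by
  rw [FreeGroup.toWord_mul, FreeGroup.toWord_mk, FreeGroup.reduce_singleton]; rfl

lemma step_norm (l g : FreeGroup α) (hl : l.norm = 1) :
    (l * g).norm = g.norm + 1 ∨ (l * g).norm + 1 = g.norm := by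
  obtain ⟨p, rfl⟩ := norm_one_eq l hl
  unfold FreeGroup.norm
  rw [toWord_step, FreeGroup.reduce.cons, FreeGroup.reduce_toWord]
  cases h : g.toWord with
  | nil => simp
  | cons hd tl =>
    dsimp only
    split_ifs <;> simp

lemma step_unique (l l' g : FreeGroup α) (hl : l.norm = 1) (hl' : l'.norm = 1)
    (h1 : (l * g).norm < g.norm) (h2 : (l' * g).norm < g.norm) : l = l' := by
  obtain ⟨p, rfl⟩ := norm_one_eq l hl
  obtain ⟨q, rfl⟩ := norm_one_eq l' hl'
  unfold FreeGroup.norm at h1 h2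
  rw [toWord_step, FreeGroup.reduce.cons, FreeGroup.reduce_toWord] at h1 h2
  cases h : g.toWord with
  | nil => rw [h] at h1; simp at h1
  | cons hd tl =>
    rw [h] at h1 h2
    dsimp only at h1 h2
    split_ifs at h1 h2 with h3 h4
    · congr 2
      exact Prod.ext (h3.1.trans h4.1.symm) (h3.2.trans h4.2.symm)
    all_goals simp at h1 h2

/-- Adjacency in the Cayley tree. -/
def Adj (g h : FreeGroup α) : Prop := (g⁻¹ * h).norm = 1

lemma Adj.symm {g h : FreeGroup α} (H : Adj g h) : Adj h g := by
  unfold Adj at *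
  rw [← FreeGroup.norm_inv_eq]; simpa using H

lemma Adj.mul {g h : FreeGroup α} (x : FreeGroup α) (H : Adj g h) : Adj (x * g) (x * h) := by
  unfold Adj at *
  simpa [mul_assoc] using H

lemma Adj.ne {g h : FreeGroup α} (H : Adj g h) : g ≠ h := by
  rintro rfl
  simp [Adj] at H

/-- distance in the Cayley tree -/
def ds (x y : FreeGroup α) : ℤ := ((x⁻¹ * y).norm : ℤ)

lemma ds_eq_zero {x y : FreeGroup α} : ds x y = 0 ↔ x = y := by
  simp [ds, inv_mul_eq_one]

lemma ds_self (x : FreeGroup α) : ds x x = 0 := ds_eq_zero.2 rfl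

lemma ds_nonneg (x y : FreeGroup α) : 0 ≤ ds x y := by unfold ds; positivity

lemma ds_mul (g x y : FreeGroup α) : ds (g * x) (g * y) = ds x y := by
  simp [ds, mul_assoc]

lemma ds_comm (x y : FreeGroup α) : ds x y = ds y x := by
  unfold ds; rw [← FreeGroup.norm_inv_eq]; simp

lemma ds_tri (x y z : FreeGroup α) : ds x z ≤ ds x y + ds y z := by
  unfold ds
  have := FreeGroup.norm_mul_le (x⁻¹ * y) (y⁻¹ * z)
  rw [show x⁻¹ * y * (y⁻¹ * z) = x⁻¹ * z by group] at this
  exact_mod_cast this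

lemma adj_ds {g h : FreeGroup α} (x : FreeGroup α) (H : Adj g h) :
    ds x h = ds x g + 1 ∨ ds x h + 1 = ds x g := by
  have := step_norm (h⁻¹ * g) (g⁻¹ * x) H.symm
  rw [show h⁻¹ * g * (g⁻¹ * x) = h⁻¹ * x by group] at this
  rw [ds_comm x h, ds_comm x g]
  unfold ds
  omega

lemma adj_unique {g h h' : FreeGroup α} (x : FreeGroup α) (H : Adj g h) (H' : Adj g h')
    (h1 : ds x h < ds x g) (h2 : ds x h' < ds x g) : h = h' := by
  have := step_unique (h⁻¹ * g) (h'⁻¹ * g) (g⁻¹ * x) H.symm H'.symm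
  rw [show h⁻¹ * g * (g⁻¹ * x) = h⁻¹ * x by group,
    show h'⁻¹ * g * (g⁻¹ * x) = h'⁻¹ * x by group] at this
  rw [ds_comm x, ds_comm x g] at h1 h2
  unfold ds at h1 h2
  simpa using this (by omega) (by omega)

/-- Non-backtracking path on `[0,n]`. -/
def NB (p : ℤ → FreeGroup α) (n : ℤ) : Prop :=
  (∀ i, 0 ≤ i → i < n → Adj (p i) (p (i + 1))) ∧ ∀ i, 0 ≤ i → i + 2 ≤ n → p i ≠ p (i + 2)

/-- Non-backtracking bi-infinite line. -/
def Line (p : ℤ → FreeGroup α) : Prop :=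
  (∀ i, Adj (p i) (p (i + 1))) ∧ ∀ i, p i ≠ p (i + 2)

lemma Line.nb {p : ℤ → FreeGroup α} (h : Line p) (k n : ℤ) : NB (fun i => p (k + i)) n := by
  refine ⟨fun i _ _ => ?_, fun i _ _ => ?_⟩
  · have := h.1 (k + i); rwa [show k + i + 1 = k + (i + 1) by ring] at this
  · have := h.2 (k + i); rwa [show k + i + 2 = k + (i + 2) by ring] at this

lemma NB.sub {p : ℤ → FreeGroup α} {n : ℤ} (h : NB p n) (k n' : ℤ) (hk : 0 ≤ k)
    (hn : k + n' ≤ n) : NB (fun i => p (k + i)) n' := by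
  refine ⟨fun i _ _ => ?_, fun i _ _ => ?_⟩
  · have := h.1 (k + i) (by omega) (by omega)
    rwa [show k + i + 1 = k + (i + 1) by ring] at this
  · have := h.2 (k + i) (by omega) (by omega)
    rwa [show k + i + 2 = k + (i + 2) by ring] at this

lemma NB.mono {p : ℤ → FreeGroup α} {n : ℤ} (h : NB p n) (n' : ℤ)
    (hn : n' ≤ n) : NB p n' :=
  ⟨fun i _ _ => h.1 i (by omega) (by omega), fun i _ _ => h.2 i (by omega) (by omega)⟩

lemma NB.rev {p : ℤ → FreeGroup α} {n : ℤ} (h : NB p n) : NB (fun i => p (n - i)) n := by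
  refine ⟨fun i _ _ => ?_, fun i _ _ => ?_⟩
  · have := h.1 (n - (i + 1)) (by omega) (by omega)
    rw [show n - (i + 1) + 1 = n - i by ring] at this
    exact this.symm
  · have := h.2 (n - (i + 2)) (by omega) (by omega)
    rw [show n - (i + 2) + 2 = n - i by ring] at this
    exact this.symm

lemma NB.mul {p : ℤ → FreeGroup α} {n : ℤ} (h : NB p n) (g : FreeGroup α) :
    NB (fun i => g * p i) n :=
  ⟨fun i h1 h2 => (h.1 i h1 h2).mul g, fun i h1 h2 h3 => h.2 i h1 h2 (mul_left_cancel h3)⟩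

lemma NB.congr {p q : ℤ → FreeGroup α} {n : ℤ} (h : NB p n)
    (H : ∀ i, 0 ≤ i → i ≤ n → q i = p i) : NB q n := by
  refine ⟨fun i _ _ => ?_, fun i _ _ => ?_⟩
  · rw [H i (by omega) (by omega), H (i+1) (by omega) (by omega)]
    exact h.1 i (by omega) (by omega)
  · rw [H i (by omega) (by omega), H (i+2) (by omega) (by omega)]
    exact h.2 i (by omega) (by omega)

lemma NB.ds_eq_nat {p : ℤ → FreeGroup α} {n : ℤ} (h : NB p n) (i : ℕ) (hi : (i : ℤ) + 1 ≤ n) :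
    ds (p 0) (p i) = i ∧ ds (p 0) (p (i + 1)) = i + 1 := by
  induction i with
  | zero =>
    refine ⟨by simp [ds_self], ?_⟩
    have := h.1 0 le_rfl (by omega)
    unfold Adj at this
    simp only [Nat.cast_zero, ds]
    rw [this]; rfl
  | succ i ih =>
    obtain ⟨h1, h2⟩ := ih (by push_cast at hi; omega)
    push_cast at hi ⊢
    refine ⟨h2, ?_⟩
    have a1 := h.1 i (by omega) (by omega)
    have a2 := h.1 (i + 1) (by omega) (by omega)
    have a3 := h.2 i (by omega) (by omega)
    rcases adj_ds (p 0) a2 with h3 | h3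
    · omega
    · exfalso
      apply a3
      refine adj_unique (p 0) a1.symm ?_ (by omega) ?_
      · rwa [show (i : ℤ) + 1 + 1 = i + 2 by ring] at a2
      · rw [show (i : ℤ) + 1 + 1 = i + 2 by ring] at h3; omega

lemma NB.ds_eq {p : ℤ → FreeGroup α} {n : ℤ} (h : NB p n) (i : ℤ) (h0 : 0 ≤ i) (hi : i ≤ n) :
    ds (p 0) (p i) = i := by
  obtain ⟨k, rfl⟩ := Int.eq_ofNat_of_zero_le h0
  rcases k with _ | k
  · simp [ds_self]
  · push_cast at *
    exact (h.ds_eq_nat k hi).2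

lemma NB.unique_aux (k : ℕ) {p q : ℤ → FreeGroup α} {n : ℤ} (h : NB p n) (h' : NB q n)
    (h0 : p 0 = q 0) (hn : p n = q n) (hk : (k : ℤ) ≤ n) : p (n - k) = q (n - k) := by
  induction k with
  | zero => simpa using hn
  | succ k ih =>
    push_cast at *
    have ih := ih (by omega)
    have a1 := h.1 (n - (k + 1)) (by omega) (by omega)
    have a2 := h'.1 (n - (k + 1)) (by omega) (by omega)
    have d1 := h.ds_eq (n - (k + 1)) (by omega) (by omega)
    have d2 := h'.ds_eq (n - (k + 1)) (by omega) (by omega)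
    have d3 := h.ds_eq (n - k) (by omega) (by omega)
    rw [show n - ((k : ℤ) + 1) + 1 = n - k by ring] at a1 a2
    rw [← ih] at a2
    rw [← h0] at d2
    exact adj_unique (p 0) a1.symm a2.symm (by omega) (by omega)

lemma NB.unique {p q : ℤ → FreeGroup α} {n n' : ℤ} (h : NB p n) (h' : NB q n') (hn0 : 0 ≤ n)
    (hn0' : 0 ≤ n')
    (h0 : p 0 = q 0) (hn : p n = q n') : n = n' ∧ ∀ i, 0 ≤ i → i ≤ n → p i = q i := by
  have e : n = n' := by
    rw [← h.ds_eq n hn0 le_rfl, ← h'.ds_eq n' hn0' le_rfl, h0, hn]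
  subst e
  refine ⟨rfl, fun i h1 h2 => ?_⟩
  obtain ⟨k, hk⟩ := Int.eq_ofNat_of_zero_le (show 0 ≤ n - i by omega)
  have := NB.unique_aux k h h' h0 hn (by omega)
  rwa [show n - (k : ℤ) = i by omega] at this

lemma exists_pred {x z : FreeGroup α} {k : ℕ} (h : ds x z = k + 1) :
    ∃ y, Adj y z ∧ ds x y = k := by
  rw [ds_comm] at h
  have h' : (z⁻¹ * x).toWord.length = k + 1 := by
    unfold ds FreeGroup.norm at h; exact_mod_cast h
  obtain ⟨hd, tl, e⟩ := List.exists_cons_of_length_eq_add_one h'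
  have e2 : z⁻¹ * x = FreeGroup.mk [hd] * FreeGroup.mk tl := by
    rw [FreeGroup.mul_mk, ← FreeGroup.mk_toWord (x := z⁻¹ * x), e]; rfl
  have hz : z = x * (FreeGroup.mk tl)⁻¹ * (FreeGroup.mk [hd])⁻¹ := by
    have : z⁻¹ = FreeGroup.mk [hd] * FreeGroup.mk tl * x⁻¹ := by rw [← e2]; group
    rw [← inv_inv z, this]; group
  have hA : Adj (x * (FreeGroup.mk tl)⁻¹) z := by
    unfold Adj
    rw [hz, show (x * (FreeGroup.mk tl)⁻¹)⁻¹ * (x * (FreeGroup.mk tl)⁻¹ * (FreeGroup.mk [hd])⁻¹)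
      = (FreeGroup.mk [hd])⁻¹ by group, FreeGroup.norm_inv_eq]
    simp [FreeGroup.norm]
  refine ⟨_, hA, ?_⟩
  have h1 := adj_ds x hA
  have h2 : ds x (x * (FreeGroup.mk tl)⁻¹) ≤ k := by
    unfold ds
    rw [show x⁻¹ * (x * (FreeGroup.mk tl)⁻¹) = (FreeGroup.mk tl)⁻¹ by group,
      FreeGroup.norm_inv_eq]
    have := FreeGroup.norm_mk_le (L₁ := tl)
    rw [e] at h'
    simp at h'
    omega
  rw [ds_comm] at h
  omega

lemma concat {p q : ℤ → FreeGroup α} {n n' : ℤ} (hp : NB p n) (hq : NB q n')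
    (e : p n = q 0) (hne : p (n - 1) ≠ q 1) :
    ∃ r : ℤ → FreeGroup α, NB r (n + n') ∧ (∀ i, i ≤ n → r i = p i) ∧
      ∀ i, 0 ≤ i → r (n + i) = q i := by
  have r2 : ∀ i, 0 ≤ i → (fun i => if i ≤ n then p i else q (i - n)) (n + i) = q i := by
    intro i hi
    dsimp only
    split_ifs with h
    · obtain rfl : i = 0 := by omega
      simpa using e
    · congr 1; ring
  have r1 : ∀ i, i ≤ n → (fun i => if i ≤ n then p i else q (i - n)) i = p i := by
    intro i hi
    simp [hi]
  refine ⟨fun i => if i ≤ n then p i else q (i - n), ?_, r1, r2⟩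
  generalize (fun i => if i ≤ n then p i else q (i - n)) = r at r1 r2
  constructor
  · intro i h0 h1
    by_cases hi : i + 1 ≤ n
    · rw [r1 i (by omega), r1 _ hi]; exact hp.1 i h0 (by omega)
    · have e1 := r2 (i - n) (by omega)
      have e2 := r2 (i - n + 1) (by omega)
      rw [show n + (i - n) = i by ring] at e1
      rw [show n + (i - n + 1) = i + 1 by ring] at e2
      rw [e1, e2]; exact hq.1 _ (by omega) (by omega)
  · intro i h0 h1
    by_cases hi : i + 2 ≤ n
    · rw [r1 i (by omega), r1 _ hi]; exact hp.2 i h0 (by omega)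
    · by_cases hi' : i + 1 = n
      · have e2 := r2 1 (by omega)
        rw [r1 i (by omega), show i + 2 = n + 1 by omega, e2, show i = n - 1 by omega]
        exact hne
      · have e1 := r2 (i - n) (by omega)
        have e2 := r2 (i - n + 2) (by omega)
        rw [show n + (i - n) = i by ring] at e1
        rw [show n + (i - n + 2) = i + 2 by ring] at e2
        rw [e1, e2]; exact hq.2 _ (by omega) (by omega)

lemma nb_edge {x y : FreeGroup α} (h : Adj x y) : NB (fun i => if i = 0 then x else y) 1 := by
  constructor
  · intro i h0 h1
    obtain rfl : i = 0 := by omega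
    simpa using h
  · intro i h0 h1; omega

lemma nb_zero (p : ℤ → FreeGroup α) : NB p 0 :=
  ⟨fun i h0 h1 => by omega, fun i h0 h1 => by omega⟩

lemma extend_path {q : ℤ → FreeGroup α} {n : ℤ} (hq : NB q n) (hn : 0 ≤ n) (k : ℕ) :
    ∀ z, ds (q n) z = k → ∃ (q' : ℤ → FreeGroup α) (s t : ℤ), 0 ≤ s ∧ 0 ≤ t ∧ s + t ≤ k ∧ s ≤ n ∧
      NB q' (n - s + t) ∧ q' (n - s + t) = z ∧ ∀ i, i ≤ n - s → q' i = q i := by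
  induction k with
  | zero =>
    intro z hz
    rw [Nat.cast_zero, ds_eq_zero] at hz
    exact ⟨q, 0, 0, le_rfl, le_rfl, by simp, hn, by simpa using hq, by simpa using hz,
      fun _ _ => rfl⟩
  | succ k ih =>
    intro z hz
    obtain ⟨y, hy, hd⟩ := exists_pred (by exact_mod_cast hz)
    obtain ⟨q', s, t, hs, ht, hst, hsn, hnb, hend, hag⟩ := ih y hd
    by_cases hb : 0 < n - s + t ∧ q' (n - s + t - 1) = z
    · by_cases h0 : t = 0
      · subst h0
        refine ⟨q', s + 1, 0, by omega, le_rfl, by push_cast; omega, by omega,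
          hnb.mono _ (by omega), ?_, fun i hi => hag i (by omega)⟩
        rw [← hb.2]; congr 1; ring
      · refine ⟨q', s, t - 1, by omega, by omega, by push_cast; omega, by omega,
          hnb.mono _ (by omega), ?_, fun i hi => hag i (by omega)⟩
        rw [← hb.2]; congr 1; ring
    · by_cases h1 : 0 < n - s + t
      · obtain ⟨r, hr, hr1, hr2⟩ := concat hnb (nb_edge hy) (by simpa using hend)
          (by simpa using fun h => hb ⟨h1, h⟩)
        refine ⟨r, s, t + 1, by omega, by omega, by push_cast; omega, by omega,
          by rwa [← add_assoc], ?_, fun i hi => ?_⟩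
        · rw [← add_assoc, hr2 1 (by omega)]; simp
        · rw [hr1 i (by omega), hag i hi]
      · refine ⟨fun i => if i ≤ 0 then q' i else z, s, t + 1, by omega, by omega, by push_cast; omega,
          by omega, ?_, ?_, fun i hi => ?_⟩
        · rw [show n - s + (t + 1) = 1 by omega]
          refine (nb_edge hy).congr ?_
          intro i h0 h1
          rcases (show i = 0 ∨ i = 1 by omega) with rfl | rfl
          · simp only [le_refl, if_true]; rw [← hend]; congr 1; omega
          · simp
        · dsimp only; rw [if_neg (by omega)]
        · dsimp only; rw [if_pos (by omega), hag i hi]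

lemma exists_path (x y : FreeGroup α) : ∃ p, NB p (ds x y) ∧ p 0 = x ∧ p (ds x y) = y := by
  obtain ⟨k, hk⟩ := Int.eq_ofNat_of_zero_le (ds_nonneg x y)
  obtain ⟨q, s, t, hs, ht, hst, hsn, hnb, hend, hag⟩ :=
    extend_path (nb_zero (fun _ => x)) le_rfl k y hk
  have e0 : q 0 = x := hag 0 (by omega)
  have := hnb.ds_eq (0 - s + t) (by omega) le_rfl
  rw [e0, hend] at this
  exact ⟨q, by rwa [this], e0, by rw [this, hend]⟩

/-- `X` is an axis of `x` with translation length `l`. -/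
structure Axis (x : FreeGroup α) (l : ℤ) (X : ℤ → FreeGroup α) : Prop where
  pos : 0 < l
  line : Line X
  tr : ∀ i, x * X i = X (i + l)

lemma Axis.zpow {x : FreeGroup α} {l : ℤ} {X : ℤ → FreeGroup α} (h : Axis x l X) (t i : ℤ) :
    x ^ t * X i = X (i + t * l) := by
  induction t using Int.induction_on generalizing i with
  | zero => simp
  | succ k ih =>
    rw [zpow_add_one, mul_assoc, h.tr, ih]; congr 1; ring
  | pred k ih =>
    rw [zpow_sub_one, mul_assoc]
    have := h.tr (i - l)
    rw [show i - l + l = i by ring] at this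
    rw [← this, inv_mul_cancel_left, ih]; congr 1; ring

lemma Axis.pow {x : FreeGroup α} {l : ℤ} {X : ℤ → FreeGroup α} (h : Axis x l X) (t : ℕ) (i : ℤ) :
    x ^ t * X i = X (i + t * l) := by
  have := h.zpow t i
  simpa using this

lemma Axis.conj {x : FreeGroup α} {l : ℤ} {X : ℤ → FreeGroup α} (h : Axis x l X)
    (g : FreeGroup α) : Axis (g * x * g⁻¹) l (fun i => g * X i) := by
  refine ⟨h.pos, ⟨fun i => (h.line.1 i).mul g, fun i hi => h.line.2 i (mul_left_cancel hi)⟩, ?_⟩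
  intro i
  rw [← h.tr]; group

lemma Axis.shift {x : FreeGroup α} {l : ℤ} {X : ℤ → FreeGroup α} (h : Axis x l X)
    (k : ℤ) : Axis x l (fun i => X (k + i)) := by
  refine ⟨h.pos, ⟨fun i => ?_, fun i => ?_⟩, fun i => ?_⟩
  · have := h.line.1 (k + i); rwa [show k + i + 1 = k + (i + 1) by ring] at this
  · have := h.line.2 (k + i); rwa [show k + i + 2 = k + (i + 2) by ring] at this
  · rw [h.tr]; congr 1; ring

lemma Axis.rev {x : FreeGroup α} {l : ℤ} {X : ℤ → FreeGroup α} (h : Axis x l X) :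
    Axis x⁻¹ l (fun i => X (-i)) := by
  refine ⟨h.pos, ⟨fun i => ?_, fun i => ?_⟩, fun i => ?_⟩
  · have := h.line.1 (-(i + 1)); rw [show -(i + 1) + 1 = -i by ring] at this; exact this.symm
  · have := h.line.2 (-(i + 2)); rw [show -(i + 2) + 2 = -i by ring] at this; exact this.symm
  · have := h.tr (-(i + l))
    rw [show -(i + l) + l = -i by ring] at this
    rw [← this]; group

lemma Axis.commute {x y : FreeGroup α} {l l' : ℤ} {X Y : ℤ → FreeGroup α} (hX : Axis x l X)
    (hY : Axis y l' Y) (g : FreeGroup α) (s t : ℤ)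
    (H : ∀ i, 0 ≤ i → i ≤ l + l' → g * X (s + i) = Y (t + i)) : Commute (g * x * g⁻¹) y := by
  have h1 := hX.pos
  have h2 := hY.pos
  have hX' := hX.conj g
  have e0 := H 0 le_rfl (by omega)
  have e1 := H l (by omega) (by omega)
  have e2 := H l' (by omega) (by omega)
  have e3 := H (l + l') (by omega) (by omega)
  have : g * x * g⁻¹ * y * Y (t + 0) = y * (g * x * g⁻¹) * Y (t + 0) := by
    rw [mul_assoc, hY.tr, mul_assoc y, ← e0, hX'.tr (s + 0)]
    rw [show t + 0 + l' = t + l' by ring, ← e2, hX'.tr (s + l')]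
    rw [show s + 0 + l = s + l by ring, e1, hY.tr,  show s + l' + l = s + (l + l') by ring, e3]
    congr 1; ring
  exact mul_right_cancel this

lemma no_swap {g u v : FreeGroup α} (h1 : g * u = v) (h2 : g * v = u) : u = v := by
  have : g ^ 2 = 1 := by
    have : g ^ 2 * u = 1 * u := by rw [pow_two, mul_assoc, h1, h2, one_mul]
    exact mul_right_cancel this
  have hg : g = 1 := by
    rwa [pow_eq_one_iff_left (by norm_num)] at this
  rw [← h1, hg, one_mul]

/-- A piece of an axis and a reversed translate of the same axis overlap in less than half a
period. -/
lemma Axis.anti {x : FreeGroup α} {l : ℤ} {X : ℤ → FreeGroup α} (hX : Axis x l X)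
    (g : FreeGroup α) (k s n : ℤ)
    (H : ∀ i, 0 ≤ i → i ≤ n → g * X (k - i) = X (s + i)) : 2 * n < l := by
  by_contra hc
  have hl := hX.pos
  obtain ⟨t, u, hu0, hu1, hu⟩ : ∃ t u : ℤ, 0 ≤ u ∧ u ≤ 2 * n ∧ k - s - t * l = u := by
    refine ⟨((k - s) / l), (k - s) % l, Int.emod_nonneg _ hl.ne', ?_, ?_⟩
    · have := Int.emod_lt_of_pos (k - s) hl; omega
    · have := Int.mul_ediv_add_emod (k - s) l; linarith
  have key : ∀ i, 0 ≤ i → i ≤ n → x ^ t * g * X (k - i) = X (k - u + i) := by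
    intro i h0 h1
    rw [mul_assoc, H i h0 h1, hX.zpow]
    congr 1; linarith
  have k1 := key (u / 2) (by omega) (by omega)
  have k2 := key (u - u / 2) (by omega) (by omega)
  rw [show k - u + u / 2 = k - (u - u / 2) by ring] at k1
  rw [show k - u + (u - u / 2) = k - u / 2 by ring] at k2
  have e := no_swap k1 k2
  by_cases h : u / 2 = u - u / 2
  · rw [← h] at k1
    have h1 : x ^ t * g = 1 := by
      have : x ^ t * g * X (k - u / 2) = 1 * X (k - u / 2) := by rw [k1, one_mul]
      exact mul_right_cancel this
    rw [h1] at key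
    simp only [one_mul] at key
    have hb := hX.line.2 (k - u / 2 - 1)
    rw [show k - u / 2 - 1 + 2 = k - u / 2 + 1 by ring] at hb
    by_cases h2 : u / 2 + 1 ≤ n
    · apply hb
      have := key (u / 2 + 1) (by omega) h2
      rw [show k - (u / 2 + 1) = k - u / 2 - 1 by ring,
        show k - u + (u / 2 + 1) = k - u / 2 + 1 by omega] at this
      exact this
    · apply hb
      have := key (u / 2 - 1) (by omega) (by omega)
      rw [show k - (u / 2 - 1) = k - u / 2 + 1 by ring,
        show k - u + (u / 2 - 1) = k - u / 2 - 1 by omega] at this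
      exact this.symm
  · have := (hX.line.1 (k - (u - u / 2))).ne
    rw [show k - (u - u / 2) + 1 = k - u / 2 by omega] at this
    exact this e.symm

/-- periodic extension -/
lemma exists_axis_ext {q : ℤ → FreeGroup α} {n : ℤ} {d : FreeGroup α} (hq : NB q n) (hn : 0 < n)
    (hd : d * q 0 = q n) (hne : q (n - 1) ≠ d * q 1) :
    ∃ W, Axis d n W ∧ ∀ i, 0 ≤ i → i ≤ n → W i = q i := by
  have tr : ∀ i, d * (fun i : ℤ => d ^ (i / n) * q (i % n)) i
      = (fun i : ℤ => d ^ (i / n) * q (i % n)) (i + n) := by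
    intro i
    dsimp only
    rw [Int.add_emod_right, Int.add_ediv_of_dvd_right (dvd_refl n), Int.ediv_self hn.ne',
      add_comm, zpow_one_add, mul_assoc]
  have ag : ∀ i, 0 ≤ i → i ≤ n → (fun i : ℤ => d ^ (i / n) * q (i % n)) i = q i := by
    intro i h0 h1
    dsimp only
    rcases h1.lt_or_eq with h | rfl
    · rw [Int.ediv_eq_zero_of_lt h0 h, Int.emod_eq_of_lt h0 h]; simp
    · rw [Int.ediv_self hn.ne', Int.emod_self]; simpa using hd
  refine ⟨fun i : ℤ => d ^ (i / n) * q (i % n), ⟨hn, ?_, tr⟩, ag⟩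
  generalize (fun i : ℤ => d ^ (i / n) * q (i % n)) = W at tr ag
  have trz : ∀ t : ℤ, ∀ i, d ^ t * W i = W (i + t * n) := by
    intro t
    induction t using Int.induction_on with
    | zero => simp
    | succ k ih =>
      intro i
      rw [zpow_add_one, mul_assoc, tr, ih]; congr 1; ring
    | pred k ih =>
      intro i
      rw [zpow_sub_one, mul_assoc]
      have := tr (i - n)
      rw [show i - n + n = i by ring] at this
      rw [← this, inv_mul_cancel_left, ih]; congr 1; ring
  have red : ∀ i, ∃ t r : ℤ, 0 ≤ r ∧ r < n ∧ ∀ k, W (i + k) = d ^ t * W (r + k) := by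
    intro i
    refine ⟨i / n, i % n, Int.emod_nonneg _ hn.ne', Int.emod_lt_of_pos _ hn, fun k => ?_⟩
    rw [trz]; congr 1
    have := Int.mul_ediv_add_emod i n; linarith
  constructor
  · intro i
    obtain ⟨t, r, h0, h1, h⟩ := red i
    rw [h 1, ← add_zero i, h 0, add_zero]
    apply Adj.mul
    rw [ag r h0 (by omega), ag (r + 1) (by omega) (by omega)]
    exact hq.1 r h0 h1
  · intro i
    obtain ⟨t, r, h0, h1, h⟩ := red i
    rw [h 2, ← add_zero i, h 0, add_zero]
    intro hh
    have hh := mul_left_cancel hh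
    rw [ag r h0 (by omega)] at hh
    by_cases h2 : r + 2 ≤ n
    · rw [ag _ (by omega) h2] at hh
      exact hq.2 r h0 h2 hh
    · rw [show r + 2 = 1 + n by omega, ← tr, ag 1 (by omega) (by omega),
        show r = n - 1 by omega] at hh
      exact hne hh

/-- trimming -/
lemma exists_axis_trim {q : ℤ → FreeGroup α} {n : ℤ} {d : FreeGroup α} (hq : NB q n) (hn : 0 < n)
    (hd : d * q 0 = q n) :
    ∃ k W, 0 ≤ k ∧ 2 * k < n ∧ Axis d (n - 2 * k) W ∧ (∀ i, 0 ≤ i → i ≤ n - 2 * k → W i = q (k + i))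
      ∧ ∀ i, 0 ≤ i → i ≤ k → d * q i = q (n - i) := by
  have hd1 : d ≠ 1 := by
    rintro rfl
    have := hq.ds_eq n hn.le le_rfl
    rw [← hd, one_mul, ds_self] at this
    omega
  have half : ∀ k : ℤ, 0 ≤ k → 2 * k ≤ n → (∀ i, 0 ≤ i → i ≤ k → d * q i = q (n - i)) →
      2 * k + 1 < n ∨ 2 * k + 1 = n ∧ d * q (k + 1) ≠ q (n - (k + 1)) := by
    intro k hk h2 H
    have hk1 := H k hk le_rfl
    rcases (show 2 * k + 1 < n ∨ 2 * k + 1 = n ∨ 2 * k = n by omega) with h | h | h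
    · exact Or.inl h
    · refine Or.inr ⟨h, fun h3 => ?_⟩
      rw [show n - k = k + 1 by omega] at hk1
      rw [show n - (k + 1) = k by omega] at h3
      exact (hq.1 k hk (by omega)).ne (no_swap hk1 h3)
    · exfalso
      apply hd1
      rw [show n - k = k by omega] at hk1
      exact mul_right_cancel (hk1.trans (one_mul _).symm)
  have main : ∀ m : ℕ, (∃ k : ℤ, 0 ≤ k ∧ 2 * k < n ∧ (∀ i, 0 ≤ i → i ≤ k → d * q i = q (n - i)) ∧
      d * q (k + 1) ≠ q (n - (k + 1))) ∨ (2 * (m : ℤ) ≤ n ∧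
        ∀ i, 0 ≤ i → i ≤ (m : ℤ) → d * q i = q (n - i)) := by
    intro m
    induction m with
    | zero =>
      right
      refine ⟨by simpa using hn.le, fun i h0 h1 => ?_⟩
      obtain rfl : i = 0 := by push_cast at h1; omega
      simpa using hd
    | succ m ih =>
      rcases ih with h | ⟨h1, h2⟩
      · exact Or.inl h
      · by_cases h3 : d * q (m + 1) = q (n - (m + 1))
        · right
          rcases half m (by omega) h1 h2 with h | h
          · refine ⟨by push_cast; omega, fun i h0 h1 => ?_⟩
            push_cast at h1
            rcases (show i ≤ m ∨ i = m + 1 by omega) with h | rfl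
            · exact h2 i h0 h
            · exact h3
          · exact absurd h3 h.2
        · left
          have := half m (by omega) h1 h2
          exact ⟨m, by omega, by omega, h2, h3⟩
  obtain ⟨k, hk0, hk1, hk2, hk3⟩ : ∃ k : ℤ, 0 ≤ k ∧ 2 * k < n ∧
      (∀ i, 0 ≤ i → i ≤ k → d * q i = q (n - i)) ∧ d * q (k + 1) ≠ q (n - (k + 1)) := by
    rcases main (n.toNat + 1) with h | h
    · exact h
    · exfalso; have := h.1; push_cast at this; omega
  obtain ⟨W, hW, hW2⟩ := exists_axis_ext (q := fun i => q (k + i)) (n := n - 2 * k) (d := d)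
    (hq.sub k _ hk0 (by omega)) (by omega)
    (by have := hk2 k hk0 le_rfl
        simp only [add_zero, this]; congr 1; ring)
    (by intro h
        apply hk3
        rw [← h]; congr 1; ring)
  exact ⟨k, W, hk0, hk1, hW, hW2, hk2⟩

lemma exists_axis {x : FreeGroup α} (hx : x ≠ 1) : ∃ l X, Axis x l X := by
  obtain ⟨p, hp, h0, h1⟩ := exists_path 1 x
  have hpos : 0 < ds 1 x := by
    have := ds_nonneg 1 x
    have h2 : ds 1 x ≠ 0 := fun h => hx (ds_eq_zero.1 h).symm
    omega
  obtain ⟨k, W, _, _, h, _⟩ := exists_axis_trim (d := x) hp hpos (by rw [h0, h1, mul_one])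
  exact ⟨_, W, h⟩

lemma exists_axis_cr {x : FreeGroup α} (hx : x ≠ 1) (hc : IsCyclicallyReduced x) :
    ∃ X, Axis x x.norm X ∧ X 0 = 1 := by
  obtain ⟨p, hp, h0, h1⟩ := exists_path 1 x
  have hpos : 0 < ds 1 x := by
    have := ds_nonneg 1 x
    have h2 : ds 1 x ≠ 0 := fun h => hx (ds_eq_zero.1 h).symm
    omega
  have hds : ds 1 x = x.norm := by simp [ds]
  obtain ⟨W, hW, hag⟩ := exists_axis_ext (d := x) hp hpos (by rw [h0, h1, mul_one]) (by
    intro h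
    have e1 := hp.ds_eq (ds 1 x - 1) (by omega) (by omega)
    have e2 := (hp.sub 1 (ds 1 x - 1) (by omega) (by omega)).ds_eq (ds 1 x - 1) (by omega) le_rfl
    simp only [add_zero] at e2
    rw [show 1 + (ds 1 x - 1) = ds 1 x by ring, h1] at e2
    have t := ds_tri 1 (p (ds 1 x - 1)) (x * x)
    have e3 : ds (p (ds 1 x - 1)) (x * x) = ds 1 x - 1 := by rw [h, ds_mul, e2]
    rw [h0] at e1
    rw [e1, e3] at t
    unfold IsCyclicallyReduced at hc
    have : ds 1 (x * x) = 2 * ds 1 x := by simp [ds, hc]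
    omega)
  exact ⟨W, hds ▸ hW, by rw [hag 0 le_rfl hpos.le, h0]⟩

/-- bridge between two lines -/
lemma exists_bridge (Y Z : ℤ → FreeGroup α) : ∃ (D i j : ℤ) (V : ℤ → FreeGroup α), 0 ≤ D ∧ NB V D ∧
    V 0 = Y i ∧ V D = Z j ∧ (0 < D → (∀ k, V 1 ≠ Y k) ∧ (∀ k, V (D - 1) ≠ Z k)
      ∧ ∀ k k', Y k ≠ Z k') := by
  classical
  have ex : ∃ D : ℕ, ∃ (i j : ℤ) (V : ℤ → FreeGroup α), NB V D ∧ V 0 = Y i ∧ V D = Z j := by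
    obtain ⟨p, hp, h0, h1⟩ := exists_path (Y 0) (Z 0)
    obtain ⟨k, hk⟩ := Int.eq_ofNat_of_zero_le (ds_nonneg (Y 0) (Z 0))
    rw [hk] at hp h1
    exact ⟨k, 0, 0, p, hp, h0, h1⟩
  obtain ⟨i, j, V, hV, h0, h1⟩ := Nat.find_spec ex
  have hmin := fun m => Nat.find_min ex (m := m)
  generalize Nat.find ex = D at *
  refine ⟨D, i, j, V, by omega, hV, h0, h1, fun hD => ⟨fun k hk => ?_, fun k hk => ?_, ?_⟩⟩
  · refine hmin (D - 1) (by omega) ⟨k, j, fun i => V (1 + i), ?_, by simpa using hk, ?_⟩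
    · exact hV.sub 1 _ (by omega) (by omega)
    · rw [← h1]; dsimp only; congr 1; omega
  · refine hmin (D - 1) (by omega) ⟨i, k, V, hV.mono _ (by omega), h0, ?_⟩
    rw [← hk]; congr 1; omega
  · intro k k' h
    refine hmin 0 (by omega) ⟨k, k', fun _ => Y k, nb_zero _, rfl, h⟩

lemma axis_unique {d : FreeGroup α} {δ δ' : ℤ} {W W' : ℤ → FreeGroup α} (h : Axis d δ W)
    (h' : Axis d δ' W') : δ = δ' ∧ ∃ k, ∀ i, W' i = W (k + i) := by
  have p1 := h.pos
  have p2 := h'.pos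
  obtain ⟨D, i, j, V, hD, hV, h0, h1, hmin⟩ := exists_bridge W W'
  rcases hD.lt_or_eq with hD | rfl
  · exfalso
    obtain ⟨m1, m2, _⟩ := hmin hD
    obtain ⟨r1, hr1, r11, r12⟩ := concat hV (h'.line.nb j δ') (by simpa using h1) (m2 _)
    have e : r1 (D + δ' - 1) = d * W' (j - 1) := by
      have := r12 (δ' - 1) (by omega)
      rw [show D + (δ' - 1) = D + δ' - 1 by ring] at this
      rw [this, h'.tr]; congr 1; ring
    obtain ⟨r2, hr2, r21, r22⟩ := concat hr1 (hV.rev.mul d)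
      (by rw [r12 δ' p2.le, ← h'.tr, ← h1]; simp)
      (by rw [e]; intro hh; exact m2 _ (mul_left_cancel hh).symm)
    have u := (h.line.nb i δ).unique hr2 p1.le (by omega)
      (by rw [r21 0 (by omega), r11 0 (by omega), h0]; simp)
      (by rw [r22 D (by omega)]; simp [h0, h.tr])
    have := u.2 1 (by omega) (by omega)
    rw [r21 1 (by omega), r11 1 (by omega)] at this
    exact m1 _ this.symm
  · have e : W i = W' j := by rw [← h0, ← h1]
    obtain ⟨e1, e2⟩ := (h.line.nb i δ).unique (h'.line.nb j δ') p1.le p2.le (by simpa using e)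
      (by rw [← h.tr, ← h'.tr, e])
    subst e1
    refine ⟨rfl, i - j, fun k => ?_⟩
    have a1 := h.zpow ((k - j) / δ) (i + (k - j) % δ)
    have a2 := h'.zpow ((k - j) / δ) (j + (k - j) % δ)
    have a3 := e2 ((k - j) % δ) (Int.emod_nonneg _ p1.ne') (Int.emod_lt_of_pos _ p1).le
    have a4 := Int.mul_ediv_add_emod (k - j) δ
    rw [a3, a2] at a1
    convert a1 using 2 <;> linarith

/-- The axis of `a^{-m} w`. -/
lemma a_side {a w : FreeGroup α} {m : ℕ} {X : ℤ → FreeGroup α} (hX : Axis a⁻¹ a.norm X)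
    (hX0 : X 0 = 1) (hm : 9 ≤ m) (hw : w.norm < a.norm) :
    ∃ δ L κ W, Axis ((a ^ m)⁻¹ * w) δ W ∧ (∀ i, 0 ≤ i → i ≤ L → W i = X (κ + i)) ∧ 0 ≤ L ∧
      L ≤ δ ∧ δ - L < a.norm ∧ (8 * (a.norm : ℤ) ≤ L ∨ L = δ ∧ 7 * (a.norm : ℤ) ≤ L) := by
  have hA := hX.pos
  generalize hAe : (a.norm : ℤ) = A at *
  obtain ⟨M, hM⟩ : ∃ M : ℤ, M = m * A := ⟨_, rfl⟩
  have hM9 : 9 * A ≤ M := by rw [hM]; gcongr; exact_mod_cast hm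
  have hend : X M = (a ^ m)⁻¹ := by
    have := hX.pow m 0
    rw [hX0, zero_add, ← hM] at this
    rw [← this]; simp
  have hwA : (w.norm : ℤ) < A := by omega
  obtain ⟨q, s, t, hs, ht, hst, hsn, hnb, hqe, hag⟩ := extend_path
    ((hX.line.nb 0 M).congr (q := X) (fun i _ _ => by simp)) (by omega) w.norm ((a ^ m)⁻¹ * w)
    (by rw [hend]; simp [ds])
  have hq0 : q 0 = 1 := by rw [hag 0 (by omega), hX0]
  obtain ⟨k, W, hk, hkn, hW, hWq, hfold⟩ := exists_axis_trim (d := (a ^ m)⁻¹ * w) hnb (by omega)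
    (by rw [hq0, hqe, mul_one])
  by_cases hkt : k ≤ t
  · refine ⟨_, M - s - k, k, W, hW, fun i h0 h1 => ?_, by omega, by omega, by omega, by omega⟩
    rw [hWq i h0 (by omega), hag _ (by omega)]
  · have hanti := hX.anti ((a ^ m)⁻¹ * w)⁻¹ (M - s) t (k - t) (fun i h0 h1 => by
      have := hfold (t + i) (by omega) (by omega)
      rw [hag _ (by omega), hag _ (by omega)] at this
      rw [inv_mul_eq_iff_eq_mul, this]; congr 1; ring)
    refine ⟨_, M - s + t - 2 * k, k, W, hW, fun i h0 h1 => ?_, by omega, by omega, by omega,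
      by omega⟩
    rw [hWq i h0 (by omega), hag _ (by omega)]

lemma exists_max (P : ℤ → Prop) (K : ℤ) (h0 : P 0)
    (hK : ∀ n, 0 ≤ n → (∀ e, 0 ≤ e → e ≤ n → P e) → n < K) :
    ∃ n, 0 ≤ n ∧ (∀ e, 0 ≤ e → e ≤ n → P e) ∧ ¬ P (n + 1) := by
  by_contra hc
  push Not at hc
  have : ∀ n : ℕ, ∀ e, 0 ≤ e → e ≤ (n : ℤ) → P e := by
    intro n
    induction n with
    | zero => intro e h1 h2; obtain rfl : e = 0 := by push_cast at h2; omega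
              exact h0
    | succ n ih =>
      intro e h1 h2
      push_cast at h2
      rcases (show e ≤ n ∨ e = n + 1 by omega) with h | rfl
      · exact ih e h1 h
      · exact hc n (by omega) ih
  have := hK K.toNat (by omega) (this _)
  omega

/-- The axis of `b^m c^j`. -/
lemma bc_side {b c : FreeGroup α} {m j : ℕ} {β γ M J : ℤ} {Y Z : ℤ → FreeGroup α} (hY : Axis b β Y)
    (hZ : Axis c γ Z) (hM : M = m * β) (hJ : J = j * γ) (hM9 : 9 * β ≤ M) (hJ7 : 7 * γ ≤ J)
    (hopp : ∀ s t n, 0 ≤ n → (∀ i, 0 ≤ i → i ≤ n → Y (s + i) = Z (t - i)) → n < β + γ) :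
    (∃ δ W D Δ C1 B1 κ κ' g, Axis (b ^ m * c ^ j) δ W ∧ δ = C1 + B1 + 2 * D ∧ 0 ≤ D ∧ 0 ≤ Δ ∧
      Δ < β + γ ∧ (D = 0 ∨ Δ = 0) ∧ C1 = J - Δ ∧ B1 = M - Δ ∧ 0 < C1 ∧ 0 < B1 ∧
      (∀ i, 0 ≤ i → i ≤ C1 → W i = Z (κ + i)) ∧
      (∀ i, C1 + D ≤ i → i ≤ C1 + D + B1 → W i = Y (κ' + i)) ∧
      (∀ i, 0 ≤ i → i ≤ D → W (C1 + D + B1 + i) = g * W (C1 + D - i))) ∨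
    (∃ δ W k κ, Axis (b ^ m * c ^ j) δ W ∧ δ = J - M - 2 * k ∧ 2 * k < γ ∧ M < β + γ ∧
      (∀ i, 0 ≤ i → i ≤ δ → W i = Z (κ + i))) ∨
    (∃ δ W k κ, Axis (b ^ m * c ^ j) δ W ∧ δ = M - J - 2 * k ∧ 2 * k < β ∧ J < β + γ ∧
      (∀ i, 0 ≤ i → i ≤ δ → W i = Y (κ + i))) := by
  have hβ := hY.pos
  have hγ := hZ.pos
  have trB : ∀ i, b ^ m * Y i = Y (i + M) := fun i => by rw [hM]; exact hY.pow m i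
  have trC : ∀ i, c ^ j * Z i = Z (i + J) := fun i => by rw [hJ]; exact hZ.pow j i
  generalize b ^ m = B at *
  generalize c ^ j = C at *
  obtain ⟨D, y, z, V, hD, hV, hV0, hV1, hmin⟩ := exists_bridge Y Z
  rcases hD.lt_or_eq with hD | rfl
  · left
    obtain ⟨m1, m2, _⟩ := hmin hD
    obtain ⟨r1, hr1, r11, r12⟩ := concat (hZ.line.nb (z - J) J) hV.rev
      (by simp [hV1]) (fun h => m2 _ h.symm)
    have e1 : r1 (J + D - 1) = V 1 := by
      have := r12 (D - 1) (by omega)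
      rw [show J + (D - 1) = J + D - 1 by ring] at this
      rw [this]; congr 1; ring
    obtain ⟨r2, hr2, r21, r22⟩ := concat hr1 (hY.line.nb y M)
      (by rw [r12 D (by omega)]; simp [hV0]) (by rw [e1]; exact m1 _)
    have e2 : r2 (J + D + M - 1) = B * Y (y - 1) := by
      have := r22 (M - 1) (by omega)
      rw [show J + D + (M - 1) = J + D + M - 1 by ring] at this
      rw [this, trB]; congr 1; ring
    obtain ⟨r3, hr3, r31, r32⟩ := concat hr2 (hV.mul B)
      (by rw [r22 M (by omega), hV0, trB])
      (by rw [e2]; intro h; exact m1 _ (mul_left_cancel h).symm)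
    have f1 : ∀ i, i ≤ J → r3 i = Z (z - J + i) := fun i hi => by
      rw [r31 i (by omega), r21 i (by omega), r11 i hi]
    have f2 : ∀ i, 0 ≤ i → i ≤ D → r3 (J + i) = V (D - i) := fun i h0 hi => by
      rw [r31 _ (by omega), r21 _ (by omega), r12 i h0]
    have f3 : ∀ i, 0 ≤ i → i ≤ M → r3 (J + D + i) = Y (y + i) := fun i h0 hi => by
      rw [r31 _ (by omega), r22 i h0]
    have e3 : r3 (J + D + M + D - 1) = B * V (D - 1) := by
      have := r32 (D - 1) (by omega)
      rwa [show J + D + M + (D - 1) = J + D + M + D - 1 by ring] at this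
    obtain ⟨W, hW, hWr⟩ := exists_axis_ext (d := B * C) hr3 (by omega)
      (by rw [f1 0 (by omega), r32 D (by omega), mul_assoc, trC, hV1]; congr 2; ring)
      (by rw [e3, f1 1 (by omega), mul_assoc, trC]; intro h; exact m2 _ (mul_left_cancel h))
    refine ⟨_, W, D, 0, J, M, z - J, y - (J + D), B, hW, by ring, by omega, by omega, by omega,
      Or.inr rfl, by omega, by omega, by omega, by omega, fun i h0 h1 => ?_, fun i h0 h1 => ?_,
      fun i h0 h1 => ?_⟩
    · rw [hWr i h0 (by omega), f1 i h1]
    · have := f3 (i - (J + D)) (by omega) (by omega)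
      rw [show J + D + (i - (J + D)) = i by ring] at this
      rw [hWr i (by omega) (by omega), this]; congr 1; ring
    · have := f2 (D - i) (by omega) (by omega)
      rw [show J + (D - i) = J + D - i by ring] at this
      rw [hWr _ (by omega) (by omega), hWr _ (by omega) (by omega), r32 i h0, this]
      congr 2; ring
  · have hyz : Y y = Z z := by rw [← hV0, ← hV1]
    obtain ⟨u, hu0, hu1, hu2⟩ := exists_max (fun e => Y (y - e) = Z (z + e)) (β + γ)
      (by simpa using hyz) (fun n hn h => hopp (y - n) (z + n) n hn (fun i h0 h1 => by
        have := h (n - i) (by omega) (by omega)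
        rw [show y - n + i = y - (n - i) by ring, this]; congr 1; ring))
    obtain ⟨y0, hy0⟩ : ∃ y0, y0 = y - u := ⟨_, rfl⟩
    obtain ⟨z0, hz0⟩ : ∃ z0, z0 = z + u := ⟨_, rfl⟩
    have hyz0 : Y y0 = Z z0 := by rw [hy0, hz0]; exact hu1 u hu0 le_rfl
    have hb : Y (y0 - 1) ≠ Z (z0 + 1) := by
      rw [hy0, hz0, show y - u - 1 = y - (u + 1) by ring, add_assoc]; exact hu2
    clear hu1 hu2 hmin hV0 hV1 hy0 hz0
    obtain ⟨Δ, hΔ0, hΔ1, hΔ2⟩ := exists_max (fun e => Y (y0 + e) = Z (z0 - e)) (β + γ)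
      (by simpa using hyz0) (fun n hn h => hopp y0 z0 n hn h)
    have hΔ := hopp y0 z0 Δ hΔ0 hΔ1
    by_cases c1 : M ≤ Δ
    · right; left
      have e1 := hΔ1 M (by omega) c1
      obtain ⟨k, W, hk, hkn, hW, hWq, hfold⟩ := exists_axis_trim (d := B * C)
        (hZ.line.nb (z0 - J) (J - M)) (by omega)
        (by rw [mul_assoc, trC, show z0 - J + 0 + J = z0 by ring, ← hyz0, trB, e1]
            congr 1; ring)
      have hanti := hZ.anti (B * C)⁻¹ (z0 - M) (z0 - J) k (fun i h0 h1 => by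
        have := hfold i h0 h1
        rw [inv_mul_eq_iff_eq_mul, this]; congr 1; ring)
      refine ⟨_, W, k, z0 - J + k, hW, rfl, hanti, by omega, fun i h0 h1 => ?_⟩
      rw [hWq i h0 h1]; congr 1; ring
    by_cases c2 : J ≤ Δ
    · right; right
      have e1 := hΔ1 J (by omega) c2
      obtain ⟨k, W, hk, hkn, hW, hWq, hfold⟩ := exists_axis_trim (d := B * C)
        (hY.line.nb (y0 + J) (M - J)) (by omega)
        (by rw [add_zero, e1, mul_assoc, trC, show z0 - J + J = z0 by ring, ← hyz0, trB]
            congr 1; ring)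
      have hanti := hY.anti (B * C)⁻¹ (y0 + M) (y0 + J) k (fun i h0 h1 => by
        have := hfold i h0 h1
        rw [inv_mul_eq_iff_eq_mul, this]; congr 1; ring)
      refine ⟨_, W, k, y0 + J + k, hW, rfl, hanti, by omega, fun i h0 h1 => ?_⟩
      rw [hWq i h0 h1]; congr 1; ring
    left
    have e1 := hΔ1 Δ hΔ0 le_rfl
    obtain ⟨r, hr, r1, r2⟩ := concat (hZ.line.nb (z0 - J) (J - Δ)) (hY.line.nb (y0 + Δ) (M - Δ))
      (by rw [add_zero, e1]; congr 1; ring)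
      (by intro h; apply hΔ2
          rw [← add_assoc, ← h]; congr 1; ring)
    have e2 : r (J - Δ + (M - Δ) - 1) = B * Y (y0 - 1) := by
      have := r2 (M - Δ - 1) (by omega)
      rw [show J - Δ + (M - Δ - 1) = J - Δ + (M - Δ) - 1 by ring] at this
      rw [this, trB]; congr 1; ring
    obtain ⟨W, hW, hWr⟩ := exists_axis_ext (d := B * C) hr (by omega)
      (by rw [r1 0 (by omega), r2 _ (by omega), mul_assoc, trC, show z0 - J + 0 + J = z0 by ring,
            ← hyz0, trB]; congr 1; ring)
      (by rw [e2, r1 1 (by omega), mul_assoc, trC]; intro h; apply hb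
          rw [mul_left_cancel h]; congr 1; ring)
    refine ⟨_, W, 0, Δ, J - Δ, M - Δ, z0 - J, y0 + Δ - (J - Δ),
      W (J - Δ + 0 + (M - Δ) + 0) * (W (J - Δ + 0 - 0))⁻¹, hW, by ring, by omega, by omega,
      by omega, Or.inl rfl, rfl, rfl, by omega, by omega, fun i h0 h1 => ?_, fun i h0 h1 => ?_,
      fun i h0 h1 => ?_⟩
    · rw [hWr i h0 (by omega), r1 i h1]
    · have := r2 (i - (J - Δ)) (by omega)
      rw [show J - Δ + (i - (J - Δ)) = i by ring] at this
      rw [hWr i (by omega) (by omega), this]; congr 1; ring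
    · obtain rfl : i = 0 := by omega
      group
set_option maxHeartbeats 2000000 in
lemma arith1 (A B C M J D Δ L δ u C1 B1 : ℤ) (hA : 0 < A) (hB : 0 < B) (hC : 0 < C)
    (hM : 9 * B ≤ M) (hJ : 7 * C ≤ J) (hD : 0 ≤ D) (hΔ : 0 ≤ Δ) (hΔ' : Δ < B + C)
    (hDΔ : D = 0 ∨ Δ = 0) (hL : L ≤ δ) (hL2 : δ - L < A) (hL3 : 8 * A ≤ L ∨ L = δ ∧ 7 * A ≤ L)
    (hC1 : C1 = J - Δ) (hB1 : B1 = M - Δ) (hC10 : 0 < C1) (hB10 : 0 < B1)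
    (hδ : δ = C1 + B1 + 2 * D) (hu : 0 ≤ u) (hu' : u < δ)
    (z1 : ∀ lo hi, u - L ≤ lo → hi ≤ u → 0 ≤ lo → hi ≤ C1 → hi - lo < A + C)
    (z2 : ∀ lo hi, u - L + δ ≤ lo → hi ≤ u + δ → 0 ≤ lo → hi ≤ C1 → hi - lo < A + C)
    (y1 : ∀ lo hi, u - L ≤ lo → hi ≤ u → C1 + D ≤ lo → hi ≤ C1 + D + B1 → hi - lo < A + B)
    (y2 : ∀ lo hi, u - L + δ ≤ lo → hi ≤ u + δ → C1 + D ≤ lo → hi ≤ C1 + D + B1 → hi - lo < A + B)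
    (v11 : ∀ e0 e1, 0 ≤ e0 → e1 ≤ D → u - L ≤ C1 + D - e1 → C1 + D + B1 + e1 ≤ u → 2 * (e1 - e0) < A)
    (v12 : ∀ e0 e1, 0 ≤ e0 → e1 ≤ D → u - L ≤ C1 + D - e1 → C1 + D - e0 ≤ u → 
      u - L + δ ≤ C1 + D + B1 + e0 → 2 * (e1 - e0) < A)
    (v22 : ∀ e0 e1, 0 ≤ e0 → e1 ≤ D → u - L + δ ≤ C1 + D - e1 → 2 * (e1 - e0) < A)
     : False := by
  rcases hDΔ with h | h
  · subst h
    have a1 := z1 (max 0 (u - L)) (min u C1) (by omega) (by omega) (by omega) (by omega)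
    have a2 := z2 (max 0 (u - L + δ)) C1 (by omega) (by omega) (by omega) (by omega)
    have a3 := y1 (max (C1 + 0) (u - L)) (min u (C1 + 0 + B1)) (by omega) (by omega) (by omega)
      (by omega)
    have a4 := y2 (max (C1 + 0) (u - L + δ)) (C1 + 0 + B1) (by omega) (by omega) (by omega)
      (by omega)
    clear z1 z2 y1 y2 v11 v12 v22
    subst hC1 hB1
    rcases le_total u (J - Δ) with h1 | h1 <;> rcases le_total (u - L + δ) (J - Δ) with h2 | h2 <;>
      rcases le_total (u - L) 0 with h3 | h3 <;> omega
  · subst h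
    rw [sub_zero] at hC1 hB1
    subst hC1 hB1
    obtain ⟨v, hv⟩ : ∃ v, v = u - L + δ := ⟨_, rfl⟩
    rw [← hv] at z2 y2 v12 v22
    have full := fun h1 h2 => y2 (C1 + D) (C1 + D + B1) h1 h2 le_rfl le_rfl
    by_cases w : u - L ≤ 0
    · rcases le_total u C1 with hu1 | hu1
      · have b1 := z1 0 u w le_rfl le_rfl hu1
        rcases le_total v C1 with hv1 | hv1
        · have b2 := z2 v C1 le_rfl (by omega) (by omega) le_rfl
          have b3 := full (by omega) (by omega)
          have b4 := v22 0 D le_rfl le_rfl (by omega)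
          omega
        rcases le_total v (C1 + D) with hv2 | hv2
        · have b3 := full (by omega) (by omega)
          have b4 := v22 0 (C1 + D - v) le_rfl (by omega) (by omega)
          omega
        rcases le_total v (C1 + D + B1) with hv3 | hv3
        · have b3 := y2 v (C1 + D + B1) le_rfl (by omega) (by omega) le_rfl
          omega
        · omega
      have b1 := z1 0 C1 w hu1 le_rfl le_rfl
      rcases le_total u (C1 + D) with hu2 | hu2
      · rcases le_total v (C1 + D) with hv2 | hv2
        · have b3 := full (by omega) (by omega)
          have b4 := v22 0 (C1 + D - v) le_rfl (by omega) (by omega)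
          have b5 := v12 (C1 + D - u) D (by omega) le_rfl (by omega) (by omega) (by omega)
          omega
        rcases le_total v (C1 + D + B1) with hv3 | hv3
        · have b3 := y2 v (C1 + D + B1) le_rfl (by omega) (by omega) le_rfl
          have b5 := v12 (C1 + D - u) D (by omega) le_rfl (by omega) (by omega) (by omega)
          omega
        · have b5 := v12 (max (C1 + D - u) (v - (C1 + D + B1))) D (by omega) le_rfl (by omega)
            (by omega) (by omega)
          omega
      rcases le_total u (C1 + D + B1) with hu3 | hu3
      · have b2 := y1 (C1 + D) u (by omega) le_rfl le_rfl hu3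
        rcases le_total v (C1 + D + B1) with hv3 | hv3
        · have b3 := y2 v (C1 + D + B1) le_rfl (by omega) (by omega) le_rfl
          have b5 := v12 0 D (by omega) le_rfl (by omega) (by omega) (by omega)
          omega
        · have b5 := v12 (v - (C1 + D + B1)) D (by omega) le_rfl (by omega) (by omega) (by omega)
          omega
      · have b2 := y1 (C1 + D) (C1 + D + B1) (by omega) hu3 le_rfl le_rfl
        have b4 := v11 0 (u - (C1 + D + B1)) (by omega) (by omega) (by omega) (by omega)
        have b5 := v12 (v - (C1 + D + B1)) D (by omega) le_rfl (by omega) (by omega) (by omega)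
        omega
    · have b1 := z1 (u - L) (C1 - (δ - L) + (u - L)) le_rfl (by omega) (by omega) (by omega)
      have b2 := y1 (C1 + D + (u - L)) (C1 + D + B1 - (δ - L) + (u - L)) (by omega) (by omega)
        (by omega) (by omega)
      have b3 := v11 0 (D - (δ - L)) le_rfl (by omega) (by omega) (by omega)
      omega

lemma arith2 (A B C M J L δ u k : ℤ) (hA : 0 < A) (hB : 0 < B) (hC : 0 < C)
    (hM : 9 * B ≤ M) (hJ : 7 * C ≤ J) (hMΔ : M < B + C)
    (hL : L ≤ δ) (hL2 : δ - L < A) (hL3 : 8 * A ≤ L ∨ L = δ ∧ 7 * A ≤ L)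
    (hk : 2 * k < C)
    (hδ : δ = J - M - 2 * k) (hu : 0 ≤ u) (hu' : u < δ)
    (z1 : ∀ lo hi, u - L ≤ lo → hi ≤ u → 0 ≤ lo → hi ≤ δ → hi - lo < A + C)
    (z2 : ∀ lo hi, u - L + δ ≤ lo → hi ≤ u + δ → 0 ≤ lo → hi ≤ δ → hi - lo < A + C)
     : False := by
  have a1 := z1 (max 0 (u - L)) (min u δ) (by omega) (by omega) (by omega) (by omega)
  have a2 := z2 (max 0 (u - L + δ)) δ (by omega) (by omega) (by omega) (by omega)
  omega
lemma arith3 (A B C M J L δ u k : ℤ) (hA : 0 < A) (hB : 0 < B) (hC : 0 < C)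
    (hM : 9 * B ≤ M) (hJ : 7 * C ≤ J) (hMΔ : J < B + C)
    (hL : L ≤ δ) (hL2 : δ - L < A) (hL3 : 8 * A ≤ L ∨ L = δ ∧ 7 * A ≤ L)
    (hk : 2 * k < B)
    (hδ : δ = M - J - 2 * k) (hu : 0 ≤ u) (hu' : u < δ)
    (z1 : ∀ lo hi, u - L ≤ lo → hi ≤ u → 0 ≤ lo → hi ≤ δ → hi - lo < A + B)
    (z2 : ∀ lo hi, u - L + δ ≤ lo → hi ≤ u + δ → 0 ≤ lo → hi ≤ δ → hi - lo < A + B)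
     : False := by
  have a1 := z1 (max 0 (u - L)) (min u δ) (by omega) (by omega) (by omega) (by omega)
  have a2 := z2 (max 0 (u - L + δ)) δ (by omega) (by omega) (by omega) (by omega)
  omega

lemma overlap_lt {x y : FreeGroup α} {A B : ℤ} {X Y W : ℤ → FreeGroup α} (hX : Axis x A X)
    (hY : Axis y B Y) (hn : ∀ g, ¬ Commute (g * x * g⁻¹) y) {g : FreeGroup α} {s s' lo hi : ℤ}
    (h1 : ∀ i, lo ≤ i → i ≤ hi → W i = g * X (s + i))
    (h2 : ∀ i, lo ≤ i → i ≤ hi → W i = Y (s' + i)) : hi - lo < A + B := by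
  by_contra hc
  refine hn g (hX.commute hY g (s + lo) (s' + lo) fun i h0 hi' => ?_)
  have a1 := h1 (lo + i) (by omega) (by omega)
  rw [h2 (lo + i) (by omega) (by omega), ← add_assoc, ← add_assoc] at a1
  exact a1.symm

lemma window {d : FreeGroup α} {δ δ' L κ : ℤ} {X W W' : ℤ → FreeGroup α} (h : Axis d δ W)
    (h' : Axis d δ' W') (hL : ∀ i, 0 ≤ i → i ≤ L → W i = X (κ + i)) :
    δ = δ' ∧ ∃ u g1 s1 g2 s2, 0 ≤ u ∧ u < δ ∧
      (∀ i, u - L ≤ i → i ≤ u → W' i = g1 * X (s1 + i)) ∧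
      (∀ i, u - L + δ ≤ i → i ≤ u + δ → W' i = g2 * X (s2 + i)) := by
  have hp := h.pos
  obtain ⟨rfl, k, hk⟩ := axis_unique h h'
  obtain ⟨t, u, hu0, hu1, hu⟩ : ∃ t u : ℤ, 0 ≤ u ∧ u < δ ∧ L - k + t * δ = u := by
    refine ⟨-((L - k) / δ), (L - k) % δ, Int.emod_nonneg _ hp.ne', Int.emod_lt_of_pos _ hp, ?_⟩
    have := Int.mul_ediv_add_emod (L - k) δ; linarith
  have key : ∀ i, u - L ≤ i → i ≤ u → W' i = d ^ t * X (κ + k - t * δ + i) := by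
    intro i h1 h2
    rw [hk, show κ + k - t * δ + i = κ + (k - t * δ + i) by ring,
      ← hL (k - t * δ + i) (by linarith) (by linarith), h.zpow]
    congr 1; ring
  refine ⟨rfl, u, d ^ t, κ + k - t * δ, d * d ^ t, κ + k - t * δ - δ, hu0, hu1, key, ?_⟩
  intro i h1 h2
  have e := h'.tr (i - δ)
  rw [show i - δ + δ = i by ring] at e
  rw [← e, key (i - δ) (by omega) (by omega), mul_assoc]
  congr 3; ring

lemma fold_lt {x : FreeGroup α} {A : ℤ} {X W : ℤ → FreeGroup α} (hX : Axis x A X)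
    {g g1 g2 : FreeGroup α} {s1 s2 p q e0 e1 : ℤ}
    (h : ∀ i, e0 ≤ i → i ≤ e1 → W (q + i) = g * W (p - i))
    (h1 : ∀ i, e0 ≤ i → i ≤ e1 → W (p - i) = g1 * X (s1 + (p - i)))
    (h2 : ∀ i, e0 ≤ i → i ≤ e1 → W (q + i) = g2 * X (s2 + (q + i))) : 2 * (e1 - e0) < A := by
  refine hX.anti (g2⁻¹ * g * g1) (s1 + p - e0) (s2 + q + e0) _ fun i h0 hi => ?_
  have a1 := h (e0 + i) (by omega) (by omega)
  rw [h1 (e0 + i) (by omega) (by omega), h2 (e0 + i) (by omega) (by omega)] at a1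
  rw [mul_assoc, mul_assoc, inv_mul_eq_iff_eq_mul]
  rw [show s1 + p - e0 - i = s1 + (p - (e0 + i)) by ring, ← a1]
  congr 2; ring

lemma main {a b c : FreeGroup α} (ha1 : a ≠ 1) (hb1 : b ≠ 1) (hc1 : c ≠ 1)
    (ha : IsCyclicallyReduced a)
    {m : ℕ} (hm : 9 ≤ m) {j : ℕ} (hj : 7 ≤ j)
    (hlen : (a ^ m * b ^ m * c ^ j).norm < a.norm)
    (nab : ∀ g, ¬ Commute (g * a⁻¹ * g⁻¹) b) (nac : ∀ g, ¬ Commute (g * a⁻¹ * g⁻¹) c)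
    (nbc : ∀ g, ¬ Commute (g * b * g⁻¹) c⁻¹) : False := by
  obtain ⟨X0, hX0, hX00⟩ := exists_axis_cr ha1 ha
  obtain ⟨X, hX, hXz⟩ : ∃ X, Axis a⁻¹ a.norm X ∧ X 0 = 1 :=
    ⟨_, hX0.rev, by simpa using hX00⟩
  clear hX0 hX00
  obtain ⟨β, Y, hY⟩ := exists_axis hb1
  obtain ⟨γ, Z, hZ⟩ := exists_axis hc1
  obtain ⟨δ, L, κ, W, hW, hWX, hL0, hLδ, hLA, hL8⟩ := a_side hX hXz hm hlen
  have hd : (a ^ m)⁻¹ * (a ^ m * b ^ m * c ^ j) = b ^ m * c ^ j := by group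
  rw [hd] at hW
  have hβ := hY.pos
  have hγ := hZ.pos
  have hA := hX.pos
  generalize (a.norm : ℤ) = A at *
  obtain ⟨M, hM⟩ : ∃ M : ℤ, M = m * β := ⟨_, rfl⟩
  obtain ⟨J, hJ⟩ : ∃ J : ℤ, J = j * γ := ⟨_, rfl⟩
  have hM9 : 9 * β ≤ M := by rw [hM]; gcongr; exact_mod_cast hm
  have hJ7 : 7 * γ ≤ J := by rw [hJ]; gcongr; exact_mod_cast hj
  have hopp : ∀ s t n, 0 ≤ n → (∀ i, 0 ≤ i → i ≤ n → Y (s + i) = Z (t - i)) → n < β + γ := by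
    intro s t n hn H
    have := overlap_lt (W := fun i => Y (s + i)) (g := 1) (s := s) (s' := -t) (lo := 0) (hi := n)
      hY hZ.rev nbc (fun i _ _ => by simp)
      (fun i h0 h1 => by rw [H i h0 h1]; congr 1; ring)
    omega
  rcases bc_side hY hZ hM hJ hM9 hJ7 hopp with
    ⟨δ', W', D, Δ, C1, B1, κ1, κ2, g, hW', hδ, hD, hΔ0, hΔ, hDΔ, hC1, hB1, hC10, hB10, hWZ, hWY,
      hWV⟩ | ⟨δ', W', k, κ1, hW', hδ, hk, hMl, hWZ⟩ | ⟨δ', W', k, κ1, hW', hδ, hk, hJl, hWY⟩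
  · obtain ⟨rfl, u, g1, s1, g2, s2, hu0, hu1, hI1, hI2⟩ := window hW hW' hWX
    refine arith1 A β γ M J D Δ L δ u C1 B1 hA hβ hγ hM9 hJ7 hD hΔ0 hΔ hDΔ hLδ hLA hL8 hC1 hB1 hC10
      hB10 hδ hu0 hu1 ?_ ?_ ?_ ?_ ?_ ?_ ?_
    · intro lo hi h1 h2 h3 h4
      exact overlap_lt hX hZ nac (fun i _ _ => hI1 i (by omega) (by omega))
        (fun i _ _ => hWZ i (by omega) (by omega))
    · intro lo hi h1 h2 h3 h4
      exact overlap_lt hX hZ nac (fun i _ _ => hI2 i (by omega) (by omega))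
        (fun i _ _ => hWZ i (by omega) (by omega))
    · intro lo hi h1 h2 h3 h4
      exact overlap_lt hX hY nab (fun i _ _ => hI1 i (by omega) (by omega))
        (fun i _ _ => hWY i (by omega) (by omega))
    · intro lo hi h1 h2 h3 h4
      exact overlap_lt hX hY nab (fun i _ _ => hI2 i (by omega) (by omega))
        (fun i _ _ => hWY i (by omega) (by omega))
    · intro e0 e1 h1 h2 h3 h4
      exact fold_lt hX (fun i _ _ => hWV i (by omega) (by omega))
        (fun i _ _ => hI1 _ (by omega) (by omega)) (fun i _ _ => hI1 _ (by omega) (by omega))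
    · intro e0 e1 h1 h2 h3 h4 h5
      exact fold_lt hX (fun i _ _ => hWV i (by omega) (by omega))
        (fun i _ _ => hI1 _ (by omega) (by omega)) (fun i _ _ => hI2 _ (by omega) (by omega))
    · intro e0 e1 h1 h2 h3
      exact fold_lt hX (fun i _ _ => hWV i (by omega) (by omega))
        (fun i _ _ => hI2 _ (by omega) (by omega)) (fun i _ _ => hI2 _ (by omega) (by omega))
  · obtain ⟨rfl, u, g1, s1, g2, s2, hu0, hu1, hI1, hI2⟩ := window hW hW' hWX
    refine arith2 A β γ M J L δ u k hA hβ hγ hM9 hJ7 hMl hLδ hLA hL8 hk hδ hu0 hu1 ?_ ?_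
    · intro lo hi h1 h2 h3 h4
      exact overlap_lt hX hZ nac (fun i _ _ => hI1 i (by omega) (by omega))
        (fun i _ _ => hWZ i (by omega) (by omega))
    · intro lo hi h1 h2 h3 h4
      exact overlap_lt hX hZ nac (fun i _ _ => hI2 i (by omega) (by omega))
        (fun i _ _ => hWZ i (by omega) (by omega))
  · obtain ⟨rfl, u, g1, s1, g2, s2, hu0, hu1, hI1, hI2⟩ := window hW hW' hWX
    refine arith3 A β γ M J L δ u k hA hβ hγ hM9 hJ7 hJl hLδ hLA hL8 hk hδ hu0 hu1 ?_ ?_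
    · intro lo hi h1 h2 h3 h4
      exact overlap_lt hX hY nab (fun i _ _ => hI1 i (by omega) (by omega))
        (fun i _ _ => hWY i (by omega) (by omega))
    · intro lo hi h1 h2 h3 h4
      exact overlap_lt hX hY nab (fun i _ _ => hI2 i (by omega) (by omega))
        (fun i _ _ => hWY i (by omega) (by omega))

end ShortProd


/-- If `a, b, c` are elements of a finitely generated free group with `a` cyclically reduced,
`m ≥ 9`, `j ∈ {7, 8}`, and `|a^m b^m c^j| < |a|`, then one of `a, b, c` commutes with a
conjugate of another one of them, or with a conjugate of the inverse of another one of them. -/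
theorem short_product_of_powers_forces_commutation {α : Type} [Fintype α] [DecidableEq α]
    (a b c : FreeGroup α) (ha : IsCyclicallyReduced a)
    (m : ℕ) (hm : 9 ≤ m) (j : ℕ) (hj : j ∈ ({7, 8} : Set ℕ))
    (hlen : (a ^ m * b ^ m * c ^ j).norm < a.norm) :
    ∃ i i' : Fin 3, i ≠ i' ∧
      ∃ g : FreeGroup α,
        Commute (![a, b, c] i) (g * ![a, b, c] i' * g⁻¹) ∨
        Commute (![a, b, c] i) (g * (![a, b, c] i')⁻¹ * g⁻¹) := by
  have hj7 : 7 ≤ j := by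
    rcases hj with rfl | rfl <;> norm_num
  by_contra hno
  have nab : ∀ g, ¬ Commute (g * a⁻¹ * g⁻¹) b := fun g h =>
    hno ⟨1, 0, by decide, g, Or.inr h.symm⟩
  have nac : ∀ g, ¬ Commute (g * a⁻¹ * g⁻¹) c := fun g h =>
    hno ⟨2, 0, by decide, g, Or.inr h.symm⟩
  have nbc : ∀ g, ¬ Commute (g * b * g⁻¹) c⁻¹ := fun g h =>
    hno ⟨2, 1, by decide, g, Or.inl (by simpa using h.symm)⟩
  refine ShortProd.main ?_ ?_ ?_ ha hm hj7 hlen nab nac nbc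
  · rintro rfl
    exact nab 1 (by simp)
  · rintro rfl
    exact nab 1 (by simp)
  · rintro rfl
    exact nac 1 (by simp)
end

section
/- Let F be the free group on the basis {a, b, x} and let n, m ≥ 1 be integers. Then the subgroup of F generated by {a, b, x²} is equal to the subgroup generated by {a, b x^{2n}, x²(b x^{2n})^m}, and the elements a, b x^{2n}, x²(b x^{2n})^m freely generate this subgroup: the homomorphism from the free group of rank 3 sending its basis elements to a, b x^{2n}, x²(b x^{2n})^m respectively is injective. -/
namespace Stmt10

/-- The generator `a` of the free group on `{a, b, x}`. -/
def a : FreeGroup (Fin 3) := FreeGroup.of 0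

/-- The generator `b` of the free group on `{a, b, x}`. -/
def b : FreeGroup (Fin 3) := FreeGroup.of 1

/-- The generator `x` of the free group on `{a, b, x}`. -/
def x : FreeGroup (Fin 3) := FreeGroup.of 2

/-- Left multiplication by `g` on both sheets. -/
def mulPerm (g : FreeGroup (Fin 3)) : Equiv.Perm (FreeGroup (Fin 3) × Bool) where
  toFun p := (g * p.1, p.2)
  invFun p := (g⁻¹ * p.1, p.2)
  left_inv p := by simp
  right_inv p := by simp

/-- A square root (on the `false` and `true` sheets) of left multiplication by `x`. -/
def rootPerm : Equiv.Perm (FreeGroup (Fin 3) × Bool) where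
  toFun p := if p.2 then (x * p.1, false) else (p.1, true)
  invFun p := if p.2 then (p.1, false) else (x⁻¹ * p.1, true)
  left_inv p := by rcases p with ⟨h, _ | _⟩ <;> simp
  right_inv p := by rcases p with ⟨h, _ | _⟩ <;> simp

/-- The action of the free group on two sheets. -/
def act : FreeGroup (Fin 3) →* Equiv.Perm (FreeGroup (Fin 3) × Bool) :=
  FreeGroup.lift ![mulPerm a, mulPerm b, rootPerm]

/-- The endomorphism `a ↦ a, b ↦ b, x ↦ x²`. -/
def sq : FreeGroup (Fin 3) →* FreeGroup (Fin 3) := FreeGroup.lift ![a, b, x ^ 2]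

theorem act_sq (w h : FreeGroup (Fin 3)) : act (sq w) (h, false) = (w * h, false) := by
  have gen : ∀ (i : Fin 3) (h : FreeGroup (Fin 3)),
      act (sq (FreeGroup.of i)) (h, false) = (FreeGroup.of i * h, false) := by
    intro i h
    fin_cases i <;> simp [act, sq, a, b, x, mulPerm, rootPerm, pow_two]
  induction w using FreeGroup.induction_on generalizing h with
  | C1 => simp
  | of i => exact gen i h
  | inv_of i _ =>
    rw [map_inv, map_inv, Equiv.Perm.inv_eq_iff_eq]
    have := gen i ((FreeGroup.of i)⁻¹ * h)
    rw [this]; simp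
  | mul u v hu hv => rw [map_mul, map_mul, Equiv.Perm.mul_apply, hv, hu, mul_assoc]

theorem sq_injective : Function.Injective sq := by
  intro u v huv
  have h1 := act_sq u 1
  rw [huv, act_sq] at h1
  simpa using h1.symm

/-- The Nielsen automorphism. -/
def niel (n m : ℕ) : FreeGroup (Fin 3) →* FreeGroup (Fin 3) :=
  FreeGroup.lift ![a, b * x ^ n, x * (b * x ^ n) ^ m]

/-- Its inverse. -/
def nielInv (n m : ℕ) : FreeGroup (Fin 3) →* FreeGroup (Fin 3) :=
  FreeGroup.lift ![a, b * ((x * (b ^ m)⁻¹) ^ n)⁻¹, x * (b ^ m)⁻¹]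

theorem niel_injective (n m : ℕ) : Function.Injective (niel n m) := by
  have h : (nielInv n m).comp (niel n m) = MonoidHom.id _ := by
    ext i
    fin_cases i <;> simp [niel, nielInv, a, b, x]
  intro u v huv
  have := congrArg (nielInv n m) huv
  rw [← MonoidHom.comp_apply, ← MonoidHom.comp_apply, h] at this
  exact this

/-- In the free group on `{a, b, x}`, for `n, m ≥ 1`, the subgroup generated by `{a, b, x²}`
equals the subgroup generated by `{a, b x^{2n}, x²(b x^{2n})^m}`, and the latter three
elements freely generate it: the homomorphism from the free group of rank 3 sending its basis
to these elements is injective. -/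
theorem closure_eq_and_freely_generated (n m : ℕ) (hn : 1 ≤ n) (hm : 1 ≤ m) :
    Subgroup.closure {a, b, x ^ 2} =
      Subgroup.closure {a, b * x ^ (2 * n), x ^ 2 * (b * x ^ (2 * n)) ^ m} ∧
    Function.Injective
      (FreeGroup.lift (![a, b * x ^ (2 * n), x ^ 2 * (b * x ^ (2 * n)) ^ m] :
        Fin 3 → FreeGroup (Fin 3))) := by
  constructor
  · apply le_antisymm
    · rw [Subgroup.closure_le]
      set K := Subgroup.closure {a, b * x ^ (2 * n), x ^ 2 * (b * x ^ (2 * n)) ^ m} with hK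
      have ha : a ∈ K := Subgroup.subset_closure (by simp)
      have hc : b * x ^ (2 * n) ∈ K := Subgroup.subset_closure (by simp)
      have hd : x ^ 2 * (b * x ^ (2 * n)) ^ m ∈ K := Subgroup.subset_closure (by simp)
      have hx : x ^ 2 ∈ K := (Subgroup.mul_mem_cancel_right K (K.pow_mem hc m)).1 hd
      have hb : b ∈ K := by
        refine (Subgroup.mul_mem_cancel_right K (K.pow_mem hx n)).1 ?_
        rwa [← pow_mul]
      rintro y (rfl | rfl | rfl)
      exacts [ha, hb, hx]
    · rw [Subgroup.closure_le]
      set K := Subgroup.closure {a, b, x ^ 2} with hK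
      have ha : a ∈ K := Subgroup.subset_closure (by simp)
      have hb : b ∈ K := Subgroup.subset_closure (by simp)
      have hx : x ^ 2 ∈ K := Subgroup.subset_closure (by simp)
      have hc : b * x ^ (2 * n) ∈ K := by
        rw [pow_mul]
        exact K.mul_mem hb (K.pow_mem hx n)
      rintro y (rfl | rfl | rfl)
      exacts [ha, hc, K.mul_mem hx (K.pow_mem hc m)]
  · have h : FreeGroup.lift (![a, b * x ^ (2 * n), x ^ 2 * (b * x ^ (2 * n)) ^ m] :
        Fin 3 → FreeGroup (Fin 3)) = sq.comp (niel n m) := by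
      ext i
      fin_cases i <;> simp [niel, sq, a, b, x, pow_mul]
    rw [h, MonoidHom.coe_comp]
    exact sq_injective.comp (niel_injective n m)

end Stmt10
end

section
/- Let L₁ be the free group on {a, b, x}, fix integers n, m ≥ 1, let u = x²(b x^{2n})^m, and let C = ⟨u⟩ be the cyclic subgroup generated by u (which is the centralizer of u in L₁). Let L₂ be the HNN extension of L₁ with stable letter t and both associated subgroups equal to C identified by the identity isomorphism, i.e., L₂ = ⟨L₁, t | t⁻¹ut = u⟩. Then the elements a, b x^{2n}, t b t⁻¹, t x t⁻¹ of L₂ freely generate a free subgroup M of rank 4: the homomorphism from the free group of rank 4 sending its basis to these four elements is injective. Moreover b ∈ M (explicitly, b = (b x^{2n}) · ((t x t⁻¹)² ((t b t⁻¹)(t x t⁻¹)^{2n})^m (b x^{2n})^{-m})^{-n}), so the subgroup ⟨a, b⟩ is contained in M. -/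
namespace Stmt11

/-- The generator `a` of the free group `L₁` on `{a, b, x}`. -/
def a : FreeGroup (Fin 3) := FreeGroup.of 0

/-- The generator `b` of the free group `L₁` on `{a, b, x}`. -/
def b : FreeGroup (Fin 3) := FreeGroup.of 1

/-- The generator `x` of the free group `L₁` on `{a, b, x}`. -/
def x : FreeGroup (Fin 3) := FreeGroup.of 2

/-- The free group `L₁` on `{a, b, x}`. -/
abbrev L₁ : Type := FreeGroup (Fin 3)

/-- The element `u = x²(b x^{2n})^m` of `L₁`. -/
def u (n m : ℕ) : L₁ := x ^ 2 * (b * x ^ (2 * n)) ^ m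

/-- The cyclic subgroup `C = ⟨u⟩` of `L₁` (the centralizer of `u`). -/
def C (n m : ℕ) : Subgroup L₁ := Subgroup.zpowers (u n m)

/-- The HNN extension `L₂ = ⟨L₁, t ∣ t⁻¹ u t = u⟩` of `L₁` with both associated subgroups
equal to `C` identified by the identity isomorphism. -/
abbrev L₂ (n m : ℕ) : Type := HNNExtension L₁ (C n m) (C n m) (MulEquiv.refl _)

/-- The canonical embedding of `L₁` into `L₂`. -/
def ι (n m : ℕ) : L₁ →* L₂ n m := HNNExtension.of

/-- The stable letter `t` of the HNN extension `L₂`. -/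
def t (n m : ℕ) : L₂ n m := HNNExtension.t

/-- The four elements `a`, `b x^{2n}`, `t b t⁻¹`, `t x t⁻¹` of the HNN extension `L₂`. -/
def gens (n m : ℕ) : Fin 4 → L₂ n m :=
  ![ι n m a, ι n m (b * x ^ (2 * n)),
    t n m * ι n m b * (t n m)⁻¹, t n m * ι n m x * (t n m)⁻¹]

/-- The endomorphism of `L₁` squaring `x`. -/
def sq : L₁ →* L₁ := FreeGroup.lift ![a, b, x ^ 2]

/-- Letterwise doubling of the letter `x`. -/
def dbl (p : Fin 3 × Bool) : List (Fin 3 × Bool) := if p.1 = 2 then [p, p] else [p]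

theorem sq_mk (L : List (Fin 3 × Bool)) :
    sq (FreeGroup.mk L) = FreeGroup.mk (L.flatMap dbl) := by
  induction L with
  | nil => simp [FreeGroup.one_eq_mk.symm]
  | cons p L ih =>
    have h1 : FreeGroup.mk (p :: L) = FreeGroup.mk [p] * FreeGroup.mk L := by
      rw [FreeGroup.mul_mk]; rfl
    rw [h1, map_mul, ih, List.flatMap_cons, ← FreeGroup.mul_mk]
    congr 1
    obtain ⟨i, e⟩ := p
    fin_cases i <;> cases e <;>
      simp [sq, dbl, a, b, x, FreeGroup.of, FreeGroup.inv_mk, FreeGroup.invRev, pow_two]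

theorem dbl_reduced (L : List (Fin 3 × Bool)) (h : FreeGroup.IsReduced L) :
    FreeGroup.IsReduced (L.flatMap dbl) ∧ (L.flatMap dbl).head? = L.head? := by
  induction L with
  | nil => simp
  | cons p L ih =>
    rw [FreeGroup.IsReduced, List.isChain_cons] at h
    obtain ⟨h1, h2⟩ := ih h.2
    simp only [FreeGroup.IsReduced] at h1
    by_cases hp : p.1 = 2
    · simp only [List.flatMap_cons, dbl, hp, if_true, List.cons_append, List.nil_append,
        FreeGroup.IsReduced, List.isChain_cons, List.head?_cons]
      rw [h2]
      rw [hp] at h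
      exact ⟨⟨by simp, h.1, h1⟩, trivial⟩
    · simp only [List.flatMap_cons, dbl, hp, if_false, List.cons_append, List.nil_append,
        FreeGroup.IsReduced, List.isChain_cons, List.head?_cons]
      rw [h2]
      exact ⟨⟨h.1, h1⟩, trivial⟩

theorem sq_injective : Function.Injective sq := by
  rw [injective_iff_map_eq_one]
  intro w hw
  rw [← FreeGroup.mk_toWord (x := w), sq_mk] at hw
  obtain ⟨h1, h2⟩ := dbl_reduced w.toWord FreeGroup.isReduced_toWord
  have h3 : (FreeGroup.mk (w.toWord.flatMap dbl)).toWord = [] := by rw [hw]; simp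
  rw [FreeGroup.toWord_mk, h1.reduce_eq] at h3
  rw [h3] at h2
  rw [← FreeGroup.toWord_eq_nil_iff]
  exact List.head?_eq_none_iff.1 h2.symm

/-- `⟨a, b x^{2n}, u⟩ → L₁`. -/
def g3 (n m : ℕ) : FreeGroup (Fin 3) →* L₁ := FreeGroup.lift ![a, b * x ^ (2 * n), u n m]

/-- `⟨b, x⟩ → L₁`. -/
def g2 : FreeGroup (Fin 2) →* L₁ := FreeGroup.lift ![b, x]

theorem g3_injective (n m : ℕ) : Function.Injective (g3 n m) := by
  let h : FreeGroup (Fin 3) →* FreeGroup (Fin 3) :=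
    FreeGroup.lift ![a, b * x ^ n, x * (b * x ^ n) ^ m]
  let e : FreeGroup (Fin 3) →* FreeGroup (Fin 3) :=
    FreeGroup.lift ![a, b * ((x * (b ^ m)⁻¹) ^ n)⁻¹, x * (b ^ m)⁻¹]
  have h1 : g3 n m = sq.comp h := by
    ext i
    fin_cases i <;> simp [g3, h, sq, a, b, x, u, pow_mul]
  have h2 : e.comp h = MonoidHom.id _ := by
    ext i
    fin_cases i <;> simp [h, e, a, b, x]
  rw [h1]
  have h3 : Function.LeftInverse e h := fun w => DFunLike.congr_fun h2 w
  exact sq_injective.comp h3.injective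

theorem g2_injective : Function.Injective g2 := by
  let e : FreeGroup (Fin 3) →* FreeGroup (Fin 2) :=
    FreeGroup.lift ![1, FreeGroup.of 0, FreeGroup.of 1]
  have h2 : e.comp g2 = MonoidHom.id _ := by
    ext i
    fin_cases i <;> simp [g2, e, b, x]
  have h3 : Function.LeftInverse e g2 := fun w => DFunLike.congr_fun h2 w
  exact h3.injective

/-- The word `u` in the free group on `{b, x}`. -/
def u2 (n m : ℕ) : FreeGroup (Fin 2) :=
  FreeGroup.of 1 ^ 2 * (FreeGroup.of 0 * FreeGroup.of 1 ^ (2 * n)) ^ m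

/-- The word `u` in the free group of rank four. -/
def u4 (n m : ℕ) : FreeGroup (Fin 4) :=
  FreeGroup.of 3 ^ 2 * (FreeGroup.of 2 * FreeGroup.of 3 ^ (2 * n)) ^ m

/-- `⟨a, b x^{2n}, u⟩` in the free group of rank four. -/
def f3 (n m : ℕ) : FreeGroup (Fin 3) →* FreeGroup (Fin 4) :=
  FreeGroup.lift ![FreeGroup.of 0, FreeGroup.of 1, u4 n m]

/-- `⟨b, x⟩` in the free group of rank four. -/
def f2 : FreeGroup (Fin 2) →* FreeGroup (Fin 4) :=
  FreeGroup.lift ![FreeGroup.of 2, FreeGroup.of 3]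

theorem t_u (n m : ℕ) : t n m * ι n m (u n m) * (t n m)⁻¹ = ι n m (u n m) := by
  have := HNNExtension.equiv_eq_conj (φ := MulEquiv.refl (C n m))
    ⟨u n m, Subgroup.mem_zpowers _⟩
  exact this.symm

theorem conj_u (n m : ℕ) :
    (t n m * ι n m x * (t n m)⁻¹) ^ 2 *
      ((t n m * ι n m b * (t n m)⁻¹) * (t n m * ι n m x * (t n m)⁻¹) ^ (2 * n)) ^ m =
    ι n m (u n m) := by
  rw [← t_u]
  have key : ∀ g, t n m * g * (t n m)⁻¹ = MulAut.conj (t n m) g := fun g => rfl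
  simp only [key, ← map_mul, ← map_pow, u]

theorem lift_f3 (n m : ℕ) (p : FreeGroup (Fin 3)) :
    FreeGroup.lift (gens n m) (f3 n m p) = ι n m (g3 n m p) := by
  have : (FreeGroup.lift (gens n m)).comp (f3 n m) = (ι n m).comp (g3 n m) := by
    ext i
    fin_cases i
    · simp [f3, g3, gens]
    · simp [f3, g3, gens]
    · have := conj_u n m
      simpa [f3, g3, gens, u4] using this
  exact DFunLike.congr_fun this p

theorem lift_f2 (n m : ℕ) (k : FreeGroup (Fin 2)) :
    FreeGroup.lift (gens n m) (f2 k) = t n m * ι n m (g2 k) * (t n m)⁻¹ := by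
  have : (FreeGroup.lift (gens n m)).comp f2 =
      (MulAut.conj (t n m)).toMonoidHom.comp ((ι n m).comp g2) := by
    ext i
    fin_cases i <;> simp [f2, g2, gens]
  exact DFunLike.congr_fun this k

theorem g2_mem (n m : ℕ) (k : FreeGroup (Fin 2)) (h : g2 k ∈ C n m) :
    ∃ p, f3 n m p = f2 k := by
  obtain ⟨j, hj⟩ := Subgroup.mem_zpowers_iff.1 h
  have h1 : g2 (u2 n m) = u n m := by simp [g2, u2, u]
  have h2 : u2 n m ^ j = k := g2_injective (by rw [map_zpow, h1, hj])
  refine ⟨FreeGroup.of 2 ^ j, ?_⟩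
  rw [← h2]
  simp [f3, f2, u4, u2]

theorem g3_mem (n m : ℕ) (p : FreeGroup (Fin 3)) (h : g3 n m p ∈ C n m) :
    ∃ k, f2 k = f3 n m p := by
  obtain ⟨j, hj⟩ := Subgroup.mem_zpowers_iff.1 h
  have h1 : g3 n m (FreeGroup.of 2) = u n m := by simp [g3]
  have h2 : FreeGroup.of 2 ^ j = p := g3_injective n m (by rw [map_zpow, h1, hj])
  refine ⟨u2 n m ^ j, ?_⟩
  rw [← h2]
  simp [f3, f2, u4, u2]

/-- Reducedness of a list of pairs. -/
def Red (n m : ℕ) (l : List (FreeGroup (Fin 2) × FreeGroup (Fin 3))) : Prop :=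
  (∀ q ∈ l, g2 q.1 ∉ C n m) ∧ l.IsChain (fun q _ => g3 n m q.2 ∉ C n m)

/-- Elements of the free group with a reduced expression. -/
def Good (n m : ℕ) (w : FreeGroup (Fin 4)) : Prop :=
  ∃ p l, Red n m l ∧ w = f3 n m p * (l.map fun q => f2 q.1 * f3 n m q.2).prod

theorem good_f3 (n m : ℕ) (p) (w) (h : Good n m w) : Good n m (f3 n m p * w) := by
  obtain ⟨p0, l, hl, rfl⟩ := h
  exact ⟨p * p0, l, hl, by simp [mul_assoc]⟩

theorem Red.tail {n m : ℕ} {q l} (h : Red n m (q :: l)) : Red n m l :=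
  ⟨fun r hr => h.1 r (List.mem_cons_of_mem _ hr), (List.isChain_cons.1 h.2).2⟩

theorem good_f2 (n m : ℕ) (k) (w) (h : Good n m w) : Good n m (f2 k * w) := by
  by_cases hk : g2 k ∈ C n m
  · obtain ⟨p, hp⟩ := g2_mem n m k hk
    rw [← hp]
    exact good_f3 n m p w h
  obtain ⟨p0, l, hl, rfl⟩ := h
  cases l with
  | nil => exact ⟨1, [(k, p0)], ⟨by simpa using hk, by simp⟩, by simp⟩
  | cons q l =>
    by_cases hp : g3 n m p0 ∈ C n m
    · obtain ⟨k', hk'⟩ := g3_mem n m p0 hp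
      have e : f2 k * (f3 n m p0 * ((q :: l).map fun q => f2 q.1 * f3 n m q.2).prod) =
          f2 (k * k' * q.1) * (f3 n m q.2 * (l.map fun q => f2 q.1 * f3 n m q.2).prod) := by
        rw [← hk']; simp [mul_assoc]
      rw [e]
      by_cases h2 : g2 (k * k' * q.1) ∈ C n m
      · obtain ⟨p, hp⟩ := g2_mem n m _ h2
        rw [← hp]
        exact good_f3 n m _ _ ⟨q.2, l, hl.tail, rfl⟩
      · refine ⟨1, (k * k' * q.1, q.2) :: l, ⟨?_, ?_⟩, by simp [mul_assoc]⟩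
        · intro r hr
          rcases List.mem_cons.1 hr with rfl | hr
          · exact h2
          · exact hl.tail.1 r hr
        · have := hl.2
          rw [List.isChain_cons] at this ⊢
          exact this
    · refine ⟨1, (k, p0) :: q :: l, ⟨?_, ?_⟩, by simp [mul_assoc]⟩
      · intro r hr
        rcases List.mem_cons.1 hr with rfl | hr
        · exact hk
        · exact hl.1 r hr
      · rw [List.isChain_cons]
        exact ⟨fun _ _ => hp, hl.2⟩

theorem good_all (n m : ℕ) (w : FreeGroup (Fin 4)) : Good n m w := by
  suffices ∀ v, Good n m v → Good n m (w * v) by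
    have h1 : Good n m 1 := ⟨1, [], ⟨by simp, by simp⟩, by simp⟩
    simpa using this 1 h1
  have hg : ∀ i : Fin 4, (∃ p, f3 n m p = FreeGroup.of i) ∨ ∃ k, f2 k = FreeGroup.of i := by
    intro i
    fin_cases i
    · exact Or.inl ⟨FreeGroup.of 0, by simp [f3]⟩
    · exact Or.inl ⟨FreeGroup.of 1, by simp [f3]⟩
    · exact Or.inr ⟨FreeGroup.of 0, by simp [f2]⟩
    · exact Or.inr ⟨FreeGroup.of 1, by simp [f2]⟩
  induction w using FreeGroup.induction_on with
  | C1 => intro v hv; simpa using hv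
  | of i =>
    intro v hv
    change Good n m (FreeGroup.of i * v)
    rcases hg i with ⟨p, hp⟩ | ⟨p, hp⟩
    · rw [← hp]; exact good_f3 n m p v hv
    · rw [← hp]; exact good_f2 n m p v hv
  | inv_of i _ =>
    intro v hv
    change Good n m ((FreeGroup.of i)⁻¹ * v)
    rcases hg i with ⟨p, hp⟩ | ⟨p, hp⟩
    · rw [← hp, ← map_inv]; exact good_f3 n m _ v hv
    · rw [← hp, ← map_inv]; exact good_f2 n m _ v hv
  | mul y z hy hz =>
    intro v hv
    rw [mul_assoc]
    exact hy _ (hz _ hv)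

/-- The letters of the reduced word in the HNN extension. -/
def letters (n m : ℕ) (l : List (FreeGroup (Fin 2) × FreeGroup (Fin 3))) : List (ℤˣ × L₁) :=
  l.flatMap fun q => [(1, g2 q.1), (-1, g3 n m q.2)]

theorem letters_chain (n m : ℕ) (l) (h : Red n m l) :
    (letters n m l).IsChain
      (fun a b => a.2 ∈ HNNExtension.toSubgroup (C n m) (C n m) a.1 → a.1 = b.1) := by
  induction l with
  | nil => simp [letters]
  | cons q l ih =>
    have ih := ih h.tail
    rw [letters, List.flatMap_cons]
    change List.IsChain _ ((1, g2 q.1) :: (-1, g3 n m q.2) :: letters n m l)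
    rw [List.isChain_cons, List.isChain_cons]
    refine ⟨fun _ _ hc => absurd hc (h.1 q List.mem_cons_self), ?_, ih⟩
    intro r hr hc
    cases l with
    | nil => simp [letters] at hr
    | cons q' l =>
      exact absurd hc ((List.isChain_cons.1 h.2).1 q' (by simp))

theorem lift_prod (n m : ℕ) (l) :
    FreeGroup.lift (gens n m) ((l.map fun q => f2 q.1 * f3 n m q.2).prod) =
      ((letters n m l).map (fun x => (HNNExtension.t : L₂ n m) ^ (x.1 : ℤ) *
        HNNExtension.of x.2)).prod := by
  induction l with
  | nil => simp [letters]
  | cons q l ih =>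
    rw [letters, List.flatMap_cons]
    change _ = (List.map _ ((1, g2 q.1) :: (-1, g3 n m q.2) :: letters n m l)).prod
    rw [List.map_cons, List.map_cons, List.map_cons, List.prod_cons, List.prod_cons,
      List.prod_cons, ← ih, map_mul, map_mul, lift_f2, lift_f3]
    simp [mul_assoc, t, ι]

theorem lift_injective (n m : ℕ) : Function.Injective (FreeGroup.lift (gens n m)) := by
  rw [injective_iff_map_eq_one]
  intro w hw
  obtain ⟨p, l, hl, rfl⟩ := good_all n m w
  rw [map_mul, lift_f3, lift_prod] at hw
  let W : HNNExtension.NormalWord.ReducedWord L₁ (C n m) (C n m) :=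
    ⟨g3 n m p, letters n m l, letters_chain n m l hl⟩
  have hW : W.prod (MulEquiv.refl (C n m)) = 1 := hw
  have h0 : W.toList = [] :=
    HNNExtension.ReducedWord.toList_eq_nil_of_mem_of_range (MulEquiv.refl (C n m)) W
      (by rw [hW]; exact one_mem _)
  change letters n m l = [] at h0
  cases l with
  | cons q l => simp [letters] at h0
  | nil =>
    rw [h0] at hw
    have h1 : g3 n m p = 1 :=
      HNNExtension.of_injective (φ := MulEquiv.refl (C n m)) (by simpa [ι] using hw)
    have h2 : p = 1 := g3_injective n m (by rw [h1, map_one])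
    simp [h2]

theorem b_eq (n m : ℕ) : ι n m b =
      ι n m (b * x ^ (2 * n)) *
        (((t n m * ι n m x * (t n m)⁻¹) ^ 2 *
            ((t n m * ι n m b * (t n m)⁻¹) * (t n m * ι n m x * (t n m)⁻¹) ^ (2 * n)) ^ m *
            (ι n m (b * x ^ (2 * n)) ^ m)⁻¹) ^ n)⁻¹ := by
  rw [conj_u, ← map_pow, ← map_inv, ← map_mul, ← map_pow, ← map_inv, ← map_mul, u,
    mul_inv_cancel_right, ← pow_mul, mul_inv_cancel_right]

/-- In the HNN extension `L₂ = ⟨L₁, t ∣ t⁻¹ u t = u⟩` with `u = x²(b x^{2n})^m`, the elements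
`a, b x^{2n}, t b t⁻¹, t x t⁻¹` freely generate a free subgroup `M` of rank 4; moreover
`b = (b x^{2n}) ((t x t⁻¹)² ((t b t⁻¹)(t x t⁻¹)^{2n})^m (b x^{2n})^{-m})^{-n}` lies in `M`, so
`⟨a, b⟩ ≤ M`. -/
theorem freely_generated_and_b_mem (n m : ℕ) (hn : 1 ≤ n) (hm : 1 ≤ m) :
    Function.Injective (FreeGroup.lift (gens n m)) ∧
    ι n m b =
      ι n m (b * x ^ (2 * n)) *
        (((t n m * ι n m x * (t n m)⁻¹) ^ 2 *
            ((t n m * ι n m b * (t n m)⁻¹) * (t n m * ι n m x * (t n m)⁻¹) ^ (2 * n)) ^ m *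
            (ι n m (b * x ^ (2 * n)) ^ m)⁻¹) ^ n)⁻¹ ∧
    Subgroup.closure {ι n m a, ι n m b} ≤
      Subgroup.closure (Set.range (gens n m)) := by
  refine ⟨lift_injective n m, b_eq n m, ?_⟩
  rw [Subgroup.closure_le]
  have h : ∀ i, gens n m i ∈ Subgroup.closure (Set.range (gens n m)) :=
    fun i => Subgroup.subset_closure ⟨i, rfl⟩
  have h1 := h 1
  have h2 := h 2
  have h3 := h 3
  simp only [gens, Matrix.cons_val] at h1 h2 h3
  rintro _ (rfl | rfl)
  · exact h 0
  · rw [b_eq n m]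
    exact mul_mem h1 (inv_mem (pow_mem (mul_mem (mul_mem (pow_mem h3 _)
      (pow_mem (mul_mem h2 (pow_mem h3 _)) _)) (inv_mem (pow_mem h1 _))) _))

end Stmt11
end

section
/- Let G be a nonabelian limit group, let u ∈ G, let C = C_G(u) be the centralizer of u in G, and let g ∈ G with g ∉ C. Let E be the HNN extension of G with stable letter t and both associated subgroups equal to C identified by the identity isomorphism (the extension of the centralizer of u). Then for every m ≥ 1, the homomorphism from the free product G * F_m (where F_m is the free group with basis x₁, …, x_m) to E that restricts to the canonical inclusion on G and sends xᵢ to tⁱ g tⁱ g tⁱ is injective. -/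
/-- A finitely generated group is a limit group (fully residually free) if every finite set of
nontrivial elements can be mapped to nontrivial elements by some homomorphism to a free
group. -/
def IsLimitGroup (G : Type*) [Group G] : Prop :=
  Group.FG G ∧
    ∀ (k : ℕ) (g : Fin k → G), (∀ i, g i ≠ 1) →
      ∃ (ι : Type) (φ : G →* FreeGroup ι), ∀ i, φ (g i) ≠ 1

/-- The extension of the centralizer of `u ∈ G`: the HNN extension of `G` with both associated
subgroups the centralizer `C_G(u)`, identified by the identity isomorphism. -/
abbrev CentralizerExtension (G : Type) [Group G] (u : G) : Type :=
  HNNExtension G (Subgroup.centralizer {u}) (Subgroup.centralizer {u}) (MulEquiv.refl _)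

section FreeGroupFacts

theorem aux_common_cyclic {α : Type} (a b : FreeGroup α) (h : a * b = b * a) :
    ∃ c : FreeGroup α, (∃ n : ℤ, a = c ^ n) ∧ (∃ k : ℤ, b = c ^ k) := by
  classical
  set H := Subgroup.closure ({a, b} : Set (FreeGroup α)) with hH
  have hcomm : ∀ x y : H, x * y = y * x := by
    have hc : ∀ x ∈ ({a, b} : Set (FreeGroup α)), ∀ y ∈ ({a, b} : Set (FreeGroup α)),
        x * y = y * x := by
      rintro x (rfl | rfl) y (rfl | rfl) <;> simp [h]
    have := Subgroup.isMulCommutative_closure hc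
    intro x y
    exact this.is_comm.comm x y
  have hfree : IsFreeGroup H := inferInstance
  have hsub : Subsingleton (IsFreeGroup.Generators H) := by
    refine ⟨fun x y => ?_⟩
    by_contra hxy
    let f : IsFreeGroup.Generators H → Equiv.Perm (Fin 3) := fun z =>
      if z = x then Equiv.swap 0 1 else Equiv.swap 1 2
    have h1 : IsFreeGroup.lift f (IsFreeGroup.of x) = Equiv.swap 0 1 := by
      rw [IsFreeGroup.lift_of]; simp [f]
    have h2 : IsFreeGroup.lift f (IsFreeGroup.of y) = Equiv.swap 1 2 := by
      rw [IsFreeGroup.lift_of]; simp [f, Ne.symm hxy]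
    have h3 := congrArg (IsFreeGroup.lift f) (hcomm (IsFreeGroup.of x) (IsFreeGroup.of y))
    rw [map_mul, map_mul, h1, h2] at h3
    revert h3
    decide
  have hcyc : ∃ c : H, ∀ x : H, ∃ n : ℤ, c ^ n = x := by
    rcases isEmpty_or_nonempty (IsFreeGroup.Generators H) with he | ⟨⟨z⟩⟩
    · refine ⟨1, fun x => ⟨0, ?_⟩⟩
      apply (IsFreeGroup.mulEquiv H).symm.injective
      exact Subsingleton.elim _ _
    · let _ : Unique (IsFreeGroup.Generators H) := uniqueOfSubsingleton z
      obtain ⟨c, hc⟩ := (inferInstance : IsCyclic (FreeGroup (IsFreeGroup.Generators H)))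
      refine ⟨IsFreeGroup.mulEquiv H c, fun x => ?_⟩
      obtain ⟨n, hn⟩ := hc ((IsFreeGroup.mulEquiv H).symm x)
      refine ⟨n, ?_⟩
      rw [← map_zpow]
      simp only at hn
      rw [hn]; simp
  obtain ⟨c, hc⟩ := hcyc
  obtain ⟨n, hn⟩ := hc ⟨a, Subgroup.subset_closure (by simp)⟩
  obtain ⟨k, hk⟩ := hc ⟨b, Subgroup.subset_closure (by simp)⟩
  refine ⟨c, ⟨n, ?_⟩, ⟨k, ?_⟩⟩
  · simpa using (congrArg Subtype.val hn).symm
  · simpa using (congrArg Subtype.val hk).symm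

/-- Unique roots: if `d` commutes with a nontrivial power of `c`, it commutes with `c`. -/
theorem aux_commute_of_zpow {α : Type} (c d : FreeGroup α) (n : ℤ) (hn : n ≠ 0)
    (h : Commute d (c ^ n)) : Commute d c := by
  have h1 : (d * c * d⁻¹) ^ n = c ^ n := by
    rw [conj_zpow]
    rw [h.eq]; group
  have h2 := zpow_left_injective hn h1
  exact mul_inv_eq_iff_eq_mul.mp h2

theorem aux_comm_trans {α : Type} (a b u : FreeGroup α) (hu : u ≠ 1)
    (ha : Commute a u) (hb : Commute b u) : Commute a b := by
  obtain ⟨c, ⟨n, hn⟩, ⟨k, hk⟩⟩ := aux_common_cyclic a u ha.eq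
  have hk0 : k ≠ 0 := by rintro rfl; simp at hk; exact hu hk
  have : Commute b c := aux_commute_of_zpow c b k hk0 (hk ▸ hb)
  rw [hn]
  exact (this.zpow_right n).symm

theorem aux_norm_pow {α : Type} [DecidableEq α] (x : FreeGroup α) (hx : x ≠ 1) :
    ∃ p r : ℕ, 0 < r ∧ ∀ n : ℤ, n ≠ 0 → (x ^ n).norm = p + n.natAbs * r := by
  refine ⟨2 * (FreeGroup.reduceCyclically.conjugator x.toWord).length,
    (FreeGroup.reduceCyclically x.toWord).length, ?_, ?_⟩
  · rw [List.length_pos_iff]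
    intro h
    have := FreeGroup.reduceCyclically.conj_conjugator_reduceCyclically x.toWord
    rw [h] at this
    apply hx
    have h2 := congrArg FreeGroup.mk this
    rw [FreeGroup.mk_toWord] at h2
    rw [← h2, List.append_nil, ← FreeGroup.mul_mk, ← FreeGroup.inv_mk, mul_inv_cancel]
  · have key : ∀ n : ℕ, n ≠ 0 → (x ^ n).norm =
        2 * (FreeGroup.reduceCyclically.conjugator x.toWord).length +
          n * (FreeGroup.reduceCyclically x.toWord).length := by
      intro n hn
      rw [FreeGroup.norm, FreeGroup.toWord_pow,
        FreeGroup.reduceCyclically.reduce_flatten_replicate FreeGroup.isReduced_toWord, if_neg hn]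
      simp
      ring
    intro n hn
    rcases Int.natAbs_eq n with h | h
    · rw [h, zpow_natCast, Int.natAbs_natCast]
      exact key _ (by omega)
    · rw [h, zpow_neg, zpow_natCast, FreeGroup.norm_inv_eq, Int.natAbs_neg, Int.natAbs_natCast]
      exact key _ (by omega)

theorem aux_bs_le {α : Type} (c g : FreeGroup α) (hc : c ≠ 1) (n k : ℤ) (hn : n ≠ 0) (hk : k ≠ 0)
    (h : g * c ^ n * g⁻¹ = c ^ k) : k.natAbs ≤ n.natAbs := by
  classical
  obtain ⟨p, r, hr, hp⟩ := aux_norm_pow c hc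
  by_contra hlt
  push Not at hlt
  set N : ℕ := 2 * g.norm + 1 with hN
  have h1 : g * c ^ (n * N) * g⁻¹ = c ^ (k * N) := by
    rw [zpow_mul, zpow_mul, ← h, conj_zpow]
  have h2 : (c ^ (k * N)).norm ≤ g.norm + (c ^ (n * N)).norm + g.norm := by
    rw [← h1]
    refine (FreeGroup.norm_mul_le _ _).trans ?_
    rw [FreeGroup.norm_inv_eq]
    have := FreeGroup.norm_mul_le g (c ^ (n * N))
    omega
  have hN0 : (N : ℤ) ≠ 0 := by omega
  rw [hp _ (mul_ne_zero hk hN0), hp _ (mul_ne_zero hn hN0), Int.natAbs_mul, Int.natAbs_mul,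
    Int.natAbs_natCast] at h2
  have h3 : (n.natAbs + 1) * N * r ≤ k.natAbs * N * r := by gcongr; omega
  have h4 : N ≤ N * r := Nat.le_mul_of_pos_right _ hr
  have h5 : (n.natAbs + 1) * N * r = n.natAbs * N * r + N * r := by ring
  omega

theorem aux_free_csa {α : Type} (a g : FreeGroup α) (ha : a ≠ 1)
    (h : Commute a (g * a * g⁻¹)) : Commute g a := by
  obtain ⟨c, ⟨n, hn⟩, ⟨k, hk⟩⟩ := aux_common_cyclic _ _ h.eq
  have hc : c ≠ 1 := by rintro rfl; simp at hn; exact ha hn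
  have hn0 : n ≠ 0 := by rintro rfl; simp at hn; exact ha hn
  have hk0 : k ≠ 0 := by
    rintro rfl
    apply ha
    simpa using hk
  have h1 : g * c ^ n * g⁻¹ = c ^ k := by rw [← hn, hk]
  have h2 : g⁻¹ * c ^ k * g⁻¹⁻¹ = c ^ n := by rw [← h1]; group
  have h3 := aux_bs_le c g hc n k hn0 hk0 h1
  have h4 := aux_bs_le c g⁻¹ hc k n hk0 hn0 h2
  rcases Int.natAbs_eq_natAbs_iff.mp (le_antisymm h4 h3) with e | e
  · subst e
    rw [hn]
    exact mul_inv_eq_iff_eq_mul.mp h1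
  · have h5 : g * a * g⁻¹ = a⁻¹ := by rw [hk, hn, e]; simp
    have h6 : Commute a (g ^ (2 : ℤ)) := by
      have : g * (g * a * g⁻¹) * g⁻¹ = a := by
        rw [h5]
        calc g * a⁻¹ * g⁻¹ = (g * a * g⁻¹)⁻¹ := by group
          _ = a := by rw [h5, inv_inv]
      have h7 : g ^ (2 : ℤ) * a = a * g ^ (2 : ℤ) := by
        calc g ^ (2 : ℤ) * a = g * (g * a * g⁻¹) * g⁻¹ * g ^ (2 : ℤ) := by rw [zpow_two]; group
          _ = _ := by rw [this]
      exact h7.symm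
    exact (aux_commute_of_zpow g a 2 (by norm_num) h6).symm

end FreeGroupFacts

/-- Malnormality of centralizers in limit groups. -/
theorem aux_limit_malnormal {G : Type} [Group G] (hG : IsLimitGroup G) (u g a : G)
    (hg : g ∉ Subgroup.centralizer ({u} : Set G)) (ha : a ≠ 1)
    (hau : a ∈ Subgroup.centralizer ({u} : Set G)) :
    g * a * g⁻¹ ∉ Subgroup.centralizer ({u} : Set G) := by
  intro hc
  rw [Subgroup.mem_centralizer_singleton_iff] at hg hau hc
  have hcomm : g * u * g⁻¹ * u⁻¹ ≠ 1 := by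
    intro h
    apply hg
    rw [mul_inv_eq_one, mul_inv_eq_iff_eq_mul] at h
    exact h
  have hu : u ≠ 1 := by rintro rfl; simp at hg
  obtain ⟨ι, φ, hφ⟩ := hG.2 3 ![a, g * u * g⁻¹ * u⁻¹, u] (by
    intro i; fin_cases i <;> simp_all)
  have h0 := hφ 0
  have h1 := hφ 1
  have h2 := hφ 2
  simp only [Matrix.cons_val] at h0 h1 h2
  have c1 : Commute (φ a) (φ u) := by
    have := congrArg φ hau; simpa [Commute, SemiconjBy] using this
  have c2 : Commute (φ (g * a * g⁻¹)) (φ u) := by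
    have := congrArg φ hc
    rw [map_mul φ _ u, map_mul φ u] at this
    exact this
  have c3 := aux_comm_trans _ _ _ h2 c1 c2
  rw [map_mul, map_mul, map_inv] at c3
  have c4 := aux_free_csa _ _ h0 c3
  have c5 := aux_comm_trans _ _ _ h0 c4 c1.symm
  apply h1
  simp only [map_mul, map_inv]
  rw [c5.eq]; group

section Words

open HNNExtension

variable {G : Type} [Group G] {u : G}

/-- `y` is represented by a reduced word with trivial head, starting with `t ^ σ`. -/
def HRed (u : G) (σ : ℤˣ) (y : CentralizerExtension G u) : Prop :=
  ∃ l : List (ℤˣ × G),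
    l.IsChain (fun a b => a.2 ∈ Subgroup.centralizer ({u} : Set G) → a.1 = b.1) ∧
    l.head?.map Prod.fst = some σ ∧
    y = (l.map (fun x => (t : CentralizerExtension G u) ^ (x.1 : ℤ) * of x.2)).prod

theorem aux_toSubgroup (C : Subgroup G) (s : ℤˣ) : toSubgroup C C s = C := by
  simp [toSubgroup]

theorem HRed.base (σ : ℤˣ) (a : G) :
    HRed u σ ((t : CentralizerExtension G u) ^ (σ : ℤ) * of a) :=
  ⟨[(σ, a)], by simp, by simp, by simp⟩

theorem HRed.step {σ τ : ℤˣ} {a : G} {y : CentralizerExtension G u} (hy : HRed u σ y)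
    (h : a ∈ Subgroup.centralizer ({u} : Set G) → τ = σ) :
    HRed u τ ((t : CentralizerExtension G u) ^ (τ : ℤ) * of a * y) := by
  obtain ⟨l, h1, h2, h3⟩ := hy
  refine ⟨(τ, a) :: l, ?_, by simp, by simp [h3]⟩
  rw [List.isChain_cons]
  refine ⟨?_, h1⟩
  intro b hb ha
  rw [Option.mem_def] at hb
  rw [hb] at h2
  simp only [Option.map_some, Option.some.injEq] at h2
  rw [h2]
  exact h ha

theorem HRed.not_range {σ : ℤˣ} {y : CentralizerExtension G u} (hy : HRed u σ y) (a : G) :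
    of a * y ≠ 1 := by
  obtain ⟨l, h1, h2, h3⟩ := hy
  intro h
  let w : NormalWord.ReducedWord G (Subgroup.centralizer ({u} : Set G))
      (Subgroup.centralizer ({u} : Set G)) := ⟨a, l, by simpa only [aux_toSubgroup] using h1⟩
  have hw : w.prod (MulEquiv.refl _) = 1 := by
    rw [← h, h3]; rfl
  have := ReducedWord.toList_eq_nil_of_mem_of_range (MulEquiv.refl _) w (by
    rw [hw]; exact one_mem _)
  have hl : l = [] := this
  rw [hl] at h2
  simp at h2

theorem HRed.pow {σ τ : ℤˣ} {a : G} {y : CentralizerExtension G u} (hy : HRed u σ y)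
    (h : a ∈ Subgroup.centralizer ({u} : Set G) → τ = σ) (n : ℕ) :
    HRed u τ ((t : CentralizerExtension G u) ^ ((τ : ℤ) * ((n : ℤ) + 1)) * of a * y) := by
  induction n with
  | zero => simpa using hy.step h
  | succ n ih =>
    have := ih.step (τ := τ) (a := 1) (fun _ => rfl)
    convert this using 1
    rw [map_one, mul_one, ← mul_assoc, ← mul_assoc, ← zpow_add]
    congr 3
    push_cast
    ring

theorem HRed.base_pow (τ : ℤˣ) (a : G) (n : ℕ) :
    HRed u τ ((t : CentralizerExtension G u) ^ ((τ : ℤ) * ((n : ℤ) + 1)) * of a) := by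
  induction n with
  | zero => simpa using HRed.base τ a
  | succ n ih =>
    have := ih.step (τ := τ) (a := 1) (fun _ => rfl)
    convert this using 1
    rw [map_one, mul_one, ← mul_assoc, ← zpow_add]
    congr 3
    push_cast
    ring

theorem aux_commute_t {a : G} (ha : a ∈ Subgroup.centralizer ({u} : Set G)) :
    Commute (t : CentralizerExtension G u) (of a) := by
  have := t_mul_of (φ := MulEquiv.refl (Subgroup.centralizer ({u} : Set G))) ⟨a, ha⟩
  exact this

/-- Any nonzero power of `t`, followed by an element outside the centralizer. -/
theorem HRed.zpow {σ : ℤˣ} {a : G} {y : CentralizerExtension G u} (hy : HRed u σ y)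
    (h : a ∉ Subgroup.centralizer ({u} : Set G)) (n : ℤ) (hn : n ≠ 0) :
    ∃ τ, HRed u τ ((t : CentralizerExtension G u) ^ n * of a * y) := by
  rcases lt_or_gt_of_ne hn with h0 | h0
  · refine ⟨-1, ?_⟩
    have := hy.pow (τ := -1) (fun h' => absurd h' h) (n.natAbs - 1)
    convert this using 4
    simp
    omega
  · refine ⟨1, ?_⟩
    have := hy.pow (τ := 1) (fun h' => absurd h' h) (n.natAbs - 1)
    convert this using 4
    simp
    omega

/-- The invariant of the image of a reduced word which begins with `x_i ^ e`. -/
def HInv (u g : G) (i : ℕ) (e : ℤˣ) (z : CentralizerExtension G u) : Prop :=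
  ∃ y, HRed u e y ∧
    z = (t : CentralizerExtension G u) ^ ((e : ℤ) * ((i : ℤ) + 1)) * of (g ^ (e : ℤ)) * y

/-- The image of `x_i ^ e`. -/
def HX (u g : G) (i : ℕ) (e : ℤˣ) : CentralizerExtension G u :=
  t ^ ((e : ℤ) * ((i : ℤ) + 1)) * of (g ^ (e : ℤ)) * t ^ ((e : ℤ) * ((i : ℤ) + 1)) *
    of (g ^ (e : ℤ)) * t ^ ((e : ℤ) * ((i : ℤ) + 1))

theorem aux_pow_not_mem {g : G} {C : Subgroup G} (hg : g ∉ C) (e : ℤˣ) : g ^ (e : ℤ) ∉ C := by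
  rcases Int.units_eq_one_or e with rfl | rfl <;> simpa using hg

theorem HInv.red {g : G} (hg : g ∉ Subgroup.centralizer ({u} : Set G)) {i : ℕ} {e : ℤˣ}
    {z : CentralizerExtension G u} (hz : HInv u g i e z) : HRed u e z := by
  obtain ⟨y, hy, rfl⟩ := hz
  exact hy.pow (fun h => absurd h (aux_pow_not_mem hg e)) i

theorem HInv.base {g : G} (hg : g ∉ Subgroup.centralizer ({u} : Set G)) (i : ℕ) (e : ℤˣ) (a : G) :
    HInv u g i e (HX u g i e * of a) := by
  refine ⟨t ^ ((e : ℤ) * ((i : ℤ) + 1)) * of (g ^ (e : ℤ)) *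
    (t ^ ((e : ℤ) * ((i : ℤ) + 1)) * of a), ?_, by simp only [HX, mul_assoc]⟩
  exact (HRed.base_pow e a i).pow (fun h => absurd h (aux_pow_not_mem hg e)) i

theorem HInv.step {g : G} (hg : g ∉ Subgroup.centralizer ({u} : Set G))
    (hmal : ∀ h a : G, h ∉ Subgroup.centralizer ({u} : Set G) → a ≠ 1 →
      a ∈ Subgroup.centralizer ({u} : Set G) →
      h * a * h⁻¹ ∉ Subgroup.centralizer ({u} : Set G))
    {i j : ℕ} {e f : ℤˣ} {a : G} {z : CentralizerExtension G u} (hz : HInv u g i e z)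
    (hne : a = 1 → i = j → f ≠ -e) :
    HInv u g j f (HX u g j f * of a * z) := by
  have hgf := aux_pow_not_mem hg f
  have hge := aux_pow_not_mem hg e
  refine ⟨t ^ ((f : ℤ) * ((j : ℤ) + 1)) * of (g ^ (f : ℤ)) *
    (t ^ ((f : ℤ) * ((j : ℤ) + 1)) * of a * z), ?_, by simp only [HX, mul_assoc]⟩
  by_cases h1 : a ∈ Subgroup.centralizer ({u} : Set G) → f = e
  · exact ((hz.red hg).pow h1 j).pow (fun h => absurd h hgf) j
  · push Not at h1
    obtain ⟨haC, hfe⟩ := h1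
    have hfe' : f = -e := Int.units_ne_iff_eq_neg.mp hfe
    obtain ⟨y, hy, rfl⟩ := hz
    have hc := (aux_commute_t haC).zpow_left ((f : ℤ) * ((j : ℤ) + 1))
    by_cases hij : i = j
    · subst hij
      have ha : a ≠ 1 := fun h => hne h rfl hfe'
      have hm := hmal (g ^ (f : ℤ)) a hgf ha haC
      have := hy.pow (τ := f) (a := g ^ (f : ℤ) * a * (g ^ (f : ℤ))⁻¹) (fun h => absurd h hm) i
      convert this using 1
      rw [hc.eq]
      subst hfe'
      simp [mul_assoc]
    · have hn : (f : ℤ) * ((j : ℤ) + 1) + (e : ℤ) * ((i : ℤ) + 1) ≠ 0 := by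
        subst hfe'
        rcases Int.units_eq_one_or e with rfl | rfl <;> simp <;> omega
      obtain ⟨τ, hτ⟩ := hy.zpow hge _ hn
      have hm : g ^ (f : ℤ) * a ∉ Subgroup.centralizer ({u} : Set G) := by
        rwa [Subgroup.mul_mem_cancel_right _ haC]
      have := hτ.pow (τ := f) (fun h => absurd h hm) j
      convert this using 1
      rw [hc.eq, zpow_add, map_mul]
      simp only [mul_assoc]

end Words

section CoprodNF

open Monoid.Coprod

variable {G : Type} [Group G] {ι : Type}

/-- Reduced words in `G ∗ F` that begin with the letter `x_i ^ e`. -/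
inductive CRed : ι → ℤˣ → Monoid.Coprod G (FreeGroup ι) → Prop
  | base (i : ι) (e : ℤˣ) (a : G) : CRed i e (inr (FreeGroup.of i) ^ (e : ℤ) * inl a)
  | cons (j : ι) (f : ℤˣ) (a : G) (i : ι) (e : ℤˣ) (w : Monoid.Coprod G (FreeGroup ι))
      (hw : CRed i e w) (h : a = 1 → i = j → f ≠ -e) :
      CRed j f (inr (FreeGroup.of j) ^ (f : ℤ) * inl a * w)

/-- An element with a reduced form. -/
def CNF (w : Monoid.Coprod G (FreeGroup ι)) : Prop :=
  (∃ a : G, w = inl a) ∨ ∃ (a : G) (i : ι) (e : ℤˣ) (w' : Monoid.Coprod G (FreeGroup ι)),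
    CRed i e w' ∧ w = inl a * w'

theorem CNF.inl_mul {w : Monoid.Coprod G (FreeGroup ι)} (h : CNF w) (b : G) :
    CNF (inl b * w) := by
  rcases h with ⟨a, rfl⟩ | ⟨a, i, e, w', h, rfl⟩
  · exact Or.inl ⟨b * a, by simp⟩
  · exact Or.inr ⟨b * a, i, e, w', h, by simp [mul_assoc]⟩

theorem CNF.gen_mul {w : Monoid.Coprod G (FreeGroup ι)} (h : CNF w) (j : ι) (f : ℤˣ) :
    CNF (inr (FreeGroup.of j) ^ (f : ℤ) * w) := by
  rcases h with ⟨a, rfl⟩ | ⟨a, i, e, w', h, rfl⟩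
  · exact Or.inr ⟨1, j, f, _, CRed.base j f a, by simp⟩
  · by_cases hc : a = 1 → i = j → f ≠ -e
    · exact Or.inr ⟨1, j, f, _, CRed.cons j f a i e w' h hc, by simp [mul_assoc]⟩
    · push Not at hc
      obtain ⟨rfl, rfl, rfl⟩ := hc
      cases h with
      | base _ _ a => exact Or.inl ⟨a, by simp⟩
      | cons _ _ a i' e' w h _ => exact Or.inr ⟨a, i', e', w, h, by simp [mul_assoc]⟩

theorem CNF.all (w : Monoid.Coprod G (FreeGroup ι)) : CNF w := by
  induction w using Monoid.Coprod.induction_on' with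
  | one => exact Or.inl ⟨1, by simp⟩
  | inl_mul a x hx => exact hx.inl_mul a
  | inr_mul n x hx =>
    induction n using FreeGroup.induction_on generalizing x with
    | C1 => simpa using hx
    | of i => simpa using hx.gen_mul i 1
    | inv_of i _ => simpa using hx.gen_mul i (-1)
    | mul p q hp hq =>
      rw [map_mul, mul_assoc]
      exact hp _ (hq _ hx)

end CoprodNF


/-- If `G` is a nonabelian limit group, `u ∈ G`, `g ∉ C_G(u)`, and `E` is the extension of the
centralizer of `u`, then for every `m ≥ 1` the homomorphism `G ∗ F_m → E` restricting to the
canonical inclusion on `G` and sending the basis element `xᵢ` of `F_m` to `tⁱ g tⁱ g tⁱ` is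
injective. -/
theorem coprod_with_free_embeds_in_centralizer_extension
    (G : Type) [Group G] (hG : IsLimitGroup G) (hna : ∃ x y : G, x * y ≠ y * x)
    (u g : G) (hg : g ∉ Subgroup.centralizer ({u} : Set G)) (m : ℕ) (hm : 1 ≤ m) :
    Function.Injective
      (Monoid.Coprod.lift
        (HNNExtension.of : G →* CentralizerExtension G u)
        (FreeGroup.lift fun i : Fin m =>
          (HNNExtension.t : CentralizerExtension G u) ^ ((i : ℕ) + 1) *
            HNNExtension.of g * (HNNExtension.t : CentralizerExtension G u) ^ ((i : ℕ) + 1) *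
            HNNExtension.of g *
            (HNNExtension.t : CentralizerExtension G u) ^ ((i : ℕ) + 1))) := by

  have hmal : ∀ h a : G, h ∉ Subgroup.centralizer ({u} : Set G) → a ≠ 1 →
      a ∈ Subgroup.centralizer ({u} : Set G) →
      h * a * h⁻¹ ∉ Subgroup.centralizer ({u} : Set G) :=
    fun h a hh ha hau => aux_limit_malnormal hG u h a hh ha hau
  set Φ := Monoid.Coprod.lift
        (HNNExtension.of : G →* CentralizerExtension G u)
        (FreeGroup.lift fun i : Fin m =>
          (HNNExtension.t : CentralizerExtension G u) ^ ((i : ℕ) + 1) *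
            HNNExtension.of g * (HNNExtension.t : CentralizerExtension G u) ^ ((i : ℕ) + 1) *
            HNNExtension.of g *
            (HNNExtension.t : CentralizerExtension G u) ^ ((i : ℕ) + 1)) with hΦ
  have hx : ∀ (i : Fin m) (e : ℤˣ),
      Φ (Monoid.Coprod.inr (FreeGroup.of i) ^ (e : ℤ)) = HX u g i e := by
    intro i e
    rw [map_zpow, hΦ, Monoid.Coprod.lift_apply_inr, FreeGroup.lift_apply_of]
    have hp : (HNNExtension.t : CentralizerExtension G u) ^ ((i : ℕ) + 1) =
        HNNExtension.t ^ (((i : ℕ) : ℤ) + 1) := by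
      rw [← zpow_natCast]; push_cast; rfl
    rw [hp]
    rcases Int.units_eq_one_or e with rfl | rfl
    · simp [HX]
    · simp only [HX, Units.val_neg, Units.val_one, zpow_neg, zpow_one, neg_mul, one_mul,
        mul_inv_rev, map_inv, mul_assoc]
  have hl : ∀ a : G, Φ (Monoid.Coprod.inl a) = HNNExtension.of a := by
    intro a
    rw [hΦ, Monoid.Coprod.lift_apply_inl]
  have key : ∀ (i : Fin m) (e : ℤˣ) w, CRed (G := G) i e w → HInv u g i e (Φ w) := by
    intro i e w h
    induction h with
    | base i e a =>
      rw [map_mul, hx, hl]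
      exact HInv.base hg i e a
    | cons j f a i e w hw h ih =>
      rw [map_mul, map_mul, hx, hl]
      exact ih.step hg hmal (fun h1 h2 => h h1 (Fin.ext h2))
  rw [injective_iff_map_eq_one]
  intro w hw
  rcases CNF.all w with ⟨a, rfl⟩ | ⟨a, i, e, w', h, rfl⟩
  · rw [hl] at hw
    have : a = 1 := HNNExtension.of_injective _ (hw.trans (map_one _).symm)
    simp [this]
  · rw [map_mul, hl] at hw
    exact absurd hw (((key i e w' h).red hg).not_range a)
end

section
/- If G₀ ≤ G₁ ≤ G₂ ≤ ⋯ is an increasing sequence of finitely generated subgroups of the abelian group ℤ × ℚ with ⋃ₙ Gₙ = ℤ × ℚ, then some Gₙ is isomorphic to the free abelian group ℤ × ℤ of rank 2. -/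
/-- If `G₀ ≤ G₁ ≤ ⋯` is an increasing chain of finitely generated subgroups of `ℤ × ℚ` whose
union is all of `ℤ × ℚ`, then some `Gₙ` is isomorphic to the free abelian group `ℤ × ℤ` of
rank 2. -/
theorem chain_exhausting_Z_times_Q_has_rank_two_term
    (G : ℕ → AddSubgroup (ℤ × ℚ)) (hmono : Monotone G)
    (hfg : ∀ n, AddGroup.FG (G n)) (hunion : ∀ x : ℤ × ℚ, ∃ n, x ∈ G n) :
    ∃ n, Nonempty ((G n) ≃+ ℤ × ℤ) := by
  obtain ⟨n, hn⟩ := hunion (1, 0)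
  obtain ⟨m, hm⟩ := hunion (0, 1)
  refine ⟨max n m, ?_⟩
  have h1 := hmono (le_max_left n m) hn
  have h2 := hmono (le_max_right n m) hm
  have hf := hfg (max n m)
  generalize G (max n m) = H at *
  haveI : Module.Finite ℤ H := Module.Finite.iff_addGroup_fg.mpr hf
  haveI : Module.IsTorsionFree ℤ H :=
    Function.Injective.moduleIsTorsionFree (H.subtype) Subtype.val_injective (by intros; simp)
  haveI : Module.Free ℤ H := inferInstance
  let f : ℤ × ℤ →ₗ[ℤ] H :=
    LinearMap.coprod (LinearMap.toSpanSingleton ℤ H ⟨_, h1⟩) (LinearMap.toSpanSingleton ℤ H ⟨_, h2⟩)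
  have hfi : Function.Injective f := by
    rintro ⟨a, b⟩ ⟨c, d⟩ h
    have h' := congrArg Subtype.val h
    simpa [f] using h'
  have hlo := LinearMap.finrank_le_finrank_of_injective hfi
  let b := Module.finBasis ℤ H
  let g : H →ₗ[ℤ] ℚ × ℚ :=
    (((Int.castAddHom ℚ).prodMap (AddMonoidHom.id ℚ)).comp H.subtype).toIntLinearMap
  have hg : Function.Injective g := by
    rintro ⟨⟨a, b⟩, hx⟩ ⟨⟨c, d⟩, hy⟩ h
    simpa [g] using h
  have hli : LinearIndependent ℤ (g ∘ b) :=
    b.linearIndependent.map' g (LinearMap.ker_eq_bot.mpr hg)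
  have hli' : LinearIndependent ℚ (g ∘ b) := (LinearIndependent.iff_fractionRing ℤ ℚ).mp hli
  have hup := hli'.fintype_card_le_finrank
  have e : Module.finrank ℤ H = Module.finrank ℤ (ℤ × ℤ) := by
    simp at hup hlo ⊢
    omega
  exact ⟨(LinearEquiv.ofFinrankEq _ _ e).toAddEquiv⟩
end
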